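/- arXiv:1708.07671 — 2 statements merged into one kernel-verified Lean document; each statement's English description precedes it below -/
import Mathlib

section
/- If m : ℕ → ℕ is a sequence with (2·m(n) − n)/n^{2/3} → −∞ as n → ∞, then the number of graphs in 𝒰(n, m(n)) is asymptotically equal to the total number of graphs on Fin n with m(n) edges; that is, |𝒰(n, m(n))| / C(C(n,2), m(n)) → 1 as n → ∞. -/
open Filter

/-- A graph has no complex component: for every connected component, the number of
edges joining two vertices of that component is at most the number of its vertices. -/
def NonComplex {n : ℕ} (G : SimpleGraph (Fin n)) : Prop :=
  ∀ c : G.ConnectedComponent,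
    {e : Sym2 (Fin n) | e ∈ G.edgeSet ∧ ∀ v ∈ e, v ∈ c.supp}.ncard ≤ c.supp.ncard

/-- `Ucard n m` is the number of simple graphs on `Fin n` with exactly `m` edges
in which no connected component is complex. -/
noncomputable def Ucard (n m : ℕ) : ℕ :=
  Nat.card {G : SimpleGraph (Fin n) // G.edgeSet.ncard = m ∧ NonComplex G}

/-- `f` restricted to `0..k-1` is a path in `G` inside `S`. -/
def PathIn {V : Type*} (G : SimpleGraph V) (S : Finset V) (k : ℕ) (f : ℕ → V) : Prop :=
  (∀ s t, s < k → t < k → f s = f t → s = t) ∧ (∀ t, t < k → f t ∈ S) ∧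
    ∀ t, t + 1 < k → G.Adj (f t) (f (t + 1))

/-- Path with two extra edges at its ends. -/
def Config {V : Type*} (G : SimpleGraph V) (k : ℕ) (f : ℕ → V) (i j : ℕ) : Prop :=
  (∀ s t, s < k → t < k → f s = f t → s = t) ∧
    (∀ t, t + 1 < k → G.Adj (f t) (f (t + 1))) ∧ 2 ≤ i ∧ i < k ∧ j + 3 ≤ k ∧
    ¬ (i + 1 = k ∧ j = 0) ∧ G.Adj (f 0) (f i) ∧ G.Adj (f (k - 1)) (f j)

lemma PathIn.rev {V : Type*} {G : SimpleGraph V} {S : Finset V} {k : ℕ} {f : ℕ → V}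
    (h : PathIn G S k f) : PathIn G S k (fun t => f (k - 1 - t)) := by
  obtain ⟨h1, h2, h3⟩ := h
  refine ⟨fun s t hs ht e => ?_, fun t ht => h2 _ (by omega), fun t ht => ?_⟩
  · have := h1 _ _ (by omega) (by omega) e
    omega
  · have := h3 (k - 1 - (t + 1)) (by omega)
    rw [show k - 1 - (t + 1) + 1 = k - 1 - t by omega] at this
    exact this.symm

lemma PathIn.cons {V : Type*} {G : SimpleGraph V} {S : Finset V} {k : ℕ} {f : ℕ → V}
    (h : PathIn G S k f) {w : V} (hw : w ∈ S) (ha : G.Adj (f 0) w)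
    (hn : ∀ i < k, w ≠ f i) : PathIn G S (k + 1) (fun t => if t = 0 then w else f (t - 1)) := by
  obtain ⟨h1, h2, h3⟩ := h
  refine ⟨fun s t hs ht e => ?_, fun t ht => ?_, fun t ht => ?_⟩
  · simp only at e
    split_ifs at e with a b b
    · omega
    · exact absurd e (hn _ (by omega))
    · exact absurd e.symm (hn _ (by omega))
    · have := h1 _ _ (by omega) (by omega) e
      omega
  · simp only
    split_ifs
    · exact hw
    · exact h2 _ (by omega)
  · simp only
    by_cases h0 : t = 0
    · subst h0
      simpa using ha.symm
    · have := h3 (t - 1) (by omega)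
      rw [show t - 1 + 1 = t by omega] at this
      simpa [h0] using this

lemma PathIn.rot {V : Type*} {G : SimpleGraph V} {S : Finset V} {k : ℕ} {f : ℕ → V}
    (h : PathIn G S k f) (hc : G.Adj (f (k - 1)) (f 0)) {r : ℕ} (hr : r < k) :
    PathIn G S k (fun t => if t + r < k then f (t + r) else f (t + r - k)) := by
  obtain ⟨h1, h2, h3⟩ := h
  refine ⟨fun s t hs ht e => ?_, fun t ht => ?_, fun t ht => ?_⟩
  · simp only at e
    split_ifs at e with a b b <;>
    · have := h1 _ _ (by omega) (by omega) e
      omega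
  · simp only
    split_ifs
    · exact h2 _ (by omega)
    · exact h2 _ (by omega)
  · simp only
    by_cases h0 : t + 1 + r < k
    · have := h3 (t + r) (by omega)
      rw [if_pos (by omega), if_pos h0, show t + 1 + r = t + r + 1 by omega]
      exact this
    · by_cases h1 : t + r < k
      · rw [if_pos h1, if_neg h0, show t + r = k - 1 by omega, show t + 1 + r - k = 0 by omega]
        exact hc
      · rw [if_neg h1, if_neg h0, show t + 1 + r - k = t + r - k + 1 by omega]
        exact h3 _ (by omega)

open Classical in
/-- edges of `G` inside `S`. -/
noncomputable def edgesIn {V : Type*} [Fintype V] (G : SimpleGraph V) (S : Finset V) :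
    Finset (Sym2 V) := Finset.univ.filter (fun e => e ∈ G.edgeSet ∧ ∀ v ∈ e, v ∈ S)

open Classical in
lemma exists_core {V : Type*} [Fintype V] (G : SimpleGraph V) (S₀ : Finset V)
    (h : S₀.card < (edgesIn G S₀).card) :
    ∃ S : Finset V, S.Nonempty ∧ ∀ C ⊆ S, C.Nonempty →
      C.card < ((edgesIn G S).filter (fun e => ∃ v ∈ C, v ∈ e)).card := by
  obtain ⟨S, hS, hmin⟩ := Finset.exists_min_image
    ((Finset.univ : Finset (Finset V)).filter (fun S => S.card < (edgesIn G S).card))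
    Finset.card ⟨S₀, by simpa using h⟩
  simp only [Finset.mem_filter, Finset.mem_univ, true_and] at hS hmin
  refine ⟨S, ?_, fun C hC hne => ?_⟩
  · rw [Finset.nonempty_iff_ne_empty]
    rintro rfl
    have : edgesIn G (∅ : Finset V) = ∅ := by
      ext e
      induction e with
      | _ a b =>
        simp [edgesIn]
        exact fun _ => ⟨a, fun h => absurd rfl h⟩
    simp [this] at hS
  · by_contra hcon
    have h1 := Finset.card_filter_add_card_filter_not (s := edgesIn G S) (fun e => ∃ v ∈ C, v ∈ e)
    have h2 : (edgesIn G S).filter (fun e => ¬ ∃ v ∈ C, v ∈ e) = edgesIn G (S \ C) := by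
      ext e
      simp only [edgesIn, Finset.mem_filter, Finset.mem_univ, true_and, Finset.mem_sdiff]
      constructor
      · rintro ⟨⟨a, b⟩, c⟩
        exact ⟨a, fun v hv => ⟨b v hv, fun hvC => c ⟨v, hvC, hv⟩⟩⟩
      · rintro ⟨a, b⟩
        exact ⟨⟨a, fun v hv => (b v hv).1⟩, fun ⟨v, hvC, hv⟩ => (b v hv).2 hvC⟩
    rw [h2] at h1
    have h3 := Finset.card_sdiff_add_card_eq_card hC
    have h4 := hne.card_pos
    have h5 := hmin (S \ C) (by omega)
    omega

open Classical in
lemma exists_config {V : Type*} [Fintype V] (G : SimpleGraph V) (S₀ : Finset V)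
    (h : S₀.card < (edgesIn G S₀).card) :
    ∃ k ≤ Fintype.card V, ∃ f i j, Config G k f i j := by
  obtain ⟨S, ⟨s, hs⟩, hC⟩ := exists_core G S₀ h
  have hle : ∀ k f, PathIn G S k f → k ≤ Fintype.card V := by
    intro k f hf
    have : Function.Injective (fun t : Fin k => f t) := fun a b e =>
      Fin.ext (hf.1 _ _ a.2 b.2 e)
    simpa using Fintype.card_le_of_injective _ this
  have hex : ∃ k f, PathIn G S k f ∧ 1 ≤ k ∧ ∀ g, ¬ PathIn G S (k + 1) g := by
    by_contra hcon
    push Not at hcon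
    have : ∀ k, ∃ f, PathIn G S (k + 1) f := by
      intro k
      induction k with
      | zero => exact ⟨fun _ => s, fun _ _ _ _ _ => by omega, fun _ _ => hs, fun _ _ => by omega⟩
      | succ k ih =>
        obtain ⟨f, hf⟩ := ih
        exact hcon _ f hf (by omega)
    obtain ⟨f, hf⟩ := this (Fintype.card V)
    have := hle _ f hf
    omega
  obtain ⟨k, f, hf, hk1, hmax⟩ := hex
  have hnb : ∀ g, PathIn G S k g → ∀ w ∈ S, G.Adj (g 0) w → ∃ i < k, w = g i := by
    intro g hg w hw ha
    by_contra hcon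
    push Not at hcon
    exact hmax _ (hg.cons hw ha hcon)
  have hA : ∀ g, PathIn G S k g → ∃ i, 2 ≤ i ∧ i < k ∧ G.Adj (g 0) (g i) := by
    intro g hg
    have h1 := hC {g 0} (by simpa using hg.2.1 0 (by omega)) (by simp)
    rw [Finset.card_singleton] at h1
    obtain ⟨e, he, hne⟩ := Finset.exists_mem_ne h1 s(g 0, g 1)
    simp only [Finset.mem_filter, edgesIn, Finset.mem_singleton, Finset.mem_univ, true_and,
      exists_eq_left] at he
    obtain ⟨⟨he1, he2⟩, he3⟩ := he
    obtain ⟨w, rfl⟩ := he3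
    have hadj : G.Adj (g 0) w := he1
    obtain ⟨i, hi, rfl⟩ := hnb g hg w (he2 w (by simp)) hadj
    refine ⟨i, ?_, hi, hadj⟩
    have : i ≠ 0 := by rintro rfl; exact hadj.ne rfl
    have : i ≠ 1 := by rintro rfl; exact hne rfl
    omega
  obtain ⟨i, hi2, hik, hia⟩ := hA f hf
  obtain ⟨j', hj2, hjk, hja⟩ := hA _ hf.rev
  simp only [Nat.sub_zero] at hja
  by_cases hcase : i + 1 = k ∧ k - 1 - j' = 0
  swap
  · exact ⟨k, hle k f hf, f, i, k - 1 - j', hf.1, hf.2.2, hi2, hik, by omega, hcase, hia, hja⟩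
  have hc : G.Adj (f (k - 1)) (f 0) := by
    rw [hcase.2] at hja
    exact hja
  by_contra hno
  have hrot : ∀ r < k, ∀ i, 2 ≤ i → i + 1 < k →
      ¬ G.Adj (f r) (if i + r < k then f (i + r) else f (i + r - k)) := by
    intro r hr i hi2 hik ha
    have hp := hf.rot hc hr
    refine hno ⟨k, hle k f hf, _, i, 0, hp.1, hp.2.2, hi2, by omega, by omega, by omega, ?_, ?_⟩
    · simpa [hr] using ha
    · simp only [Nat.zero_add, hr, if_true]
      by_cases h0 : r = 0
      · subst h0
        rw [if_pos (by omega)]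
        exact hc
      · rw [if_neg (by omega)]
        have := hf.2.2 (r - 1) (by omega)
        rw [show r - 1 + 1 = r by omega] at this
        rwa [show k - 1 + r - k = r - 1 by omega]
  have hfin := hC ((Finset.range k).image f) (by
    intro v hv
    simp only [Finset.mem_image, Finset.mem_range] at hv
    obtain ⟨t, ht, rfl⟩ := hv
    exact hf.2.1 t ht) ⟨f 0, by simp only [Finset.mem_image, Finset.mem_range]; exact ⟨0, by omega, rfl⟩⟩
  rw [Finset.card_image_of_injOn (by
    intro a ha b hb e
    exact hf.1 a b (by simpa using ha) (by simpa using hb) e), Finset.card_range] at hfin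
  have hsub : ((edgesIn G S).filter (fun e => ∃ v ∈ (Finset.range k).image f, v ∈ e)) ⊆
      (Finset.range k).image (fun t => s(f t, if t + 1 < k then f (t + 1) else f 0)) := by
    intro e he
    simp only [Finset.mem_filter, edgesIn, Finset.mem_univ, true_and, Finset.mem_image,
      Finset.mem_range, exists_exists_and_eq_and] at he ⊢
    obtain ⟨⟨he1, he2⟩, r, hr, w, rfl⟩ := he
    have hadj : G.Adj (f r) w := he1
    obtain ⟨i, hi, hw⟩ := hnb _ (hf.rot hc hr) w (he2 w (by simp)) (by simpa [hr] using hadj)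
    by_cases hi0 : i = 0
    · subst hi0
      simp only [Nat.zero_add, hr, if_true] at hw
      exact absurd hw.symm hadj.ne
    by_cases hi1 : i = 1
    · subst hi1
      refine ⟨r, hr, ?_⟩
      rw [hw, Nat.add_comm 1 r]
      split_ifs with h1
      · rfl
      · rw [show r + 1 - k = 0 by omega]
    by_cases hik : i + 1 < k
    · exact absurd (hw ▸ hadj) (hrot r hr i (by omega) hik)
    by_cases h0 : r = 0
    · subst h0
      refine ⟨k - 1, by omega, ?_⟩
      rw [if_neg (by omega), hw, if_pos (by omega), Sym2.eq_swap]
      rw [show i + 0 = k - 1 by omega]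
    · refine ⟨r - 1, by omega, ?_⟩
      rw [if_pos (by omega), hw, if_neg (by omega), Sym2.eq_swap,
        show i + r - k = r - 1 by omega, show r - 1 + 1 = r by omega]
  have := Finset.card_le_card hsub
  have h2 := Finset.card_image_le (s := Finset.range k)
    (f := fun t => s(f t, if t + 1 < k then f (t + 1) else f 0))
  rw [Finset.card_range] at h2
  omega

lemma desc_bound {m N : ℕ} (h : m ≤ N) (a : ℕ) :
    m.descFactorial a * N ^ a ≤ N.descFactorial a * m ^ a := by
  induction a with
  | zero => simp
  | succ a ih =>
    rw [Nat.descFactorial_succ, Nat.descFactorial_succ, pow_succ, pow_succ]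
    have : (m - a) * N ≤ (N - a) * m := by
      rw [Nat.sub_mul, Nat.sub_mul, Nat.mul_comm m N]
      exact Nat.sub_le_sub_left (Nat.mul_le_mul_left a h) _
    calc (m - a) * m.descFactorial a * (N ^ a * N)
        = (m.descFactorial a * N ^ a) * ((m - a) * N) := by ring
      _ ≤ (N.descFactorial a * m ^ a) * ((N - a) * m) := Nat.mul_le_mul ih this
      _ = _ := by ring

lemma card_superset {α : Type*} [DecidableEq α] (U F : Finset α) (m : ℕ) (hm : m ≤ U.card) :
    (((U.powersetCard m).filter (fun E => F ⊆ E)).card) * U.card ^ F.card ≤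
      m ^ F.card * U.card.choose m := by
  by_cases hne : ((U.powersetCard m).filter (fun E => F ⊆ E)).Nonempty
  swap
  · rw [Finset.not_nonempty_iff_eq_empty.1 hne]
    simp
  obtain ⟨E₀, hE₀⟩ := hne
  simp only [Finset.mem_filter, Finset.mem_powersetCard] at hE₀
  have hFU : F ⊆ U := hE₀.2.trans hE₀.1.1
  have hFm : F.card ≤ m := hE₀.1.2 ▸ Finset.card_le_card hE₀.2
  have h1 : ((U.powersetCard m).filter (fun E => F ⊆ E)).card ≤
      ((U \ F).powersetCard (m - F.card)).card := by
    apply Finset.card_le_card_of_injOn (fun E => E \ F)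
    · intro E hE
      simp only [Finset.coe_filter, Finset.mem_powersetCard, Set.mem_ofPred_eq] at hE
      simp only [Finset.mem_coe, Finset.mem_powersetCard]
      refine ⟨Finset.sdiff_subset_sdiff hE.1.1 le_rfl, ?_⟩
      rw [Finset.card_sdiff_of_subset hE.2, hE.1.2]
    · intro E hE E' hE' e
      simp only [Finset.coe_filter, Finset.mem_powersetCard, Set.mem_ofPred_eq] at hE hE' e
      rw [← Finset.sdiff_union_of_subset hE.2, e, Finset.sdiff_union_of_subset hE'.2]
  rw [Finset.card_powersetCard, Finset.card_sdiff_of_subset hFU] at h1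
  have h2 := Nat.choose_mul (n := U.card) hFm
  have h3 := desc_bound hm F.card
  rw [Nat.descFactorial_eq_factorial_mul_choose, Nat.descFactorial_eq_factorial_mul_choose,
    mul_assoc, mul_assoc] at h3
  have h3 := Nat.le_of_mul_le_mul_left h3 (Nat.factorial_pos _)
  have hpos : 0 < U.card.choose F.card := Nat.choose_pos (Finset.card_le_card hFU)
  refine (Nat.mul_le_mul_right _ h1).trans ?_
  refine Nat.le_of_mul_le_mul_left ?_ hpos
  calc _ = (U.card.choose F.card * (U.card - F.card).choose (m - F.card)) * U.card ^ F.card := by ring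
    _ = U.card.choose m * (m.choose F.card * U.card ^ F.card) := by rw [← h2]; ring
    _ ≤ U.card.choose m * (U.card.choose F.card * m ^ F.card) := Nat.mul_le_mul_left _ h3
    _ = _ := by ring

/-- The edge number `t` of a configuration. -/
def cfgEdge {V : Type*} (k : ℕ) (f : ℕ → V) (i j t : ℕ) : Sym2 V :=
  if t + 1 < k then s(f t, f (t + 1)) else if t + 1 = k then s(f 0, f i) else s(f (k - 1), f j)

lemma Config.inj {V : Type*} {G : SimpleGraph V} {k : ℕ} {f : ℕ → V} {i j : ℕ}
    (h : Config G k f i j) : Set.InjOn (cfgEdge k f i j) (Finset.range (k + 1) : Set ℕ) := by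
  obtain ⟨h1, h2, h3, h4, h5, h6, h7, h8⟩ := h
  have key : ∀ a b c d, a < k → b < k → c < k → d < k → s(f a, f b) = s(f c, f d) →
      (a = c ∧ b = d) ∨ (a = d ∧ b = c) := by
    intro a b c d ha hb hc hd e
    rw [Sym2.eq_iff] at e
    rcases e with ⟨e1, e2⟩ | ⟨e1, e2⟩
    · exact Or.inl ⟨h1 _ _ ha hc e1, h1 _ _ hb hd e2⟩
    · exact Or.inr ⟨h1 _ _ ha hd e1, h1 _ _ hb hc e2⟩
  intro s hs t ht e
  simp only [Finset.coe_range, Set.mem_Iio] at hs ht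
  unfold cfgEdge at e
  split_ifs at e <;> first
    | omega
    | (have := key _ _ _ _ (by omega) (by omega) (by omega) (by omega) e
       omega)

lemma Config.mem {V : Type*} {G : SimpleGraph V} {k : ℕ} {f : ℕ → V} {i j : ℕ}
    (h : Config G k f i j) (t : ℕ) : cfgEdge k f i j t ∈ G.edgeSet := by
  obtain ⟨h1, h2, h3, h4, h5, h6, h7, h8⟩ := h
  unfold cfgEdge
  split_ifs with a b
  · exact h2 t a
  · exact h7
  · exact h8

open Classical in
lemma card_config {n : ℕ} (U : Finset (Sym2 (Fin n))) (m : ℕ) (hm : m ≤ U.card)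
    (k : ℕ) (f : ℕ → Fin n) (i j : ℕ) :
    ((U.powersetCard m).filter
      (fun E : Finset (Sym2 (Fin n)) => Config (SimpleGraph.fromEdgeSet (E : Set (Sym2 (Fin n)))) k f i j)).card
        * U.card ^ (k + 1) ≤ m ^ (k + 1) * U.card.choose m := by
  by_cases hne : ((U.powersetCard m).filter
      (fun E : Finset (Sym2 (Fin n)) => Config (SimpleGraph.fromEdgeSet (E : Set (Sym2 (Fin n)))) k f i j)).Nonempty
  swap
  · rw [Finset.not_nonempty_iff_eq_empty.1 hne]
    simp
  obtain ⟨E₀, hE₀⟩ := hne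
  have hcard : ((Finset.range (k + 1)).image (cfgEdge k f i j)).card = k + 1 := by
    rw [Finset.card_image_of_injOn (Finset.mem_filter.1 hE₀).2.inj, Finset.card_range]
  have := card_superset U ((Finset.range (k + 1)).image (cfgEdge k f i j)) m hm
  rw [hcard] at this
  refine le_trans (Nat.mul_le_mul_right _ (Finset.card_le_card ?_)) this
  intro E hE
  rw [Finset.mem_filter] at hE
  refine Finset.mem_filter.2 ⟨hE.1, ?_⟩
  intro e he
  obtain ⟨t, -, rfl⟩ := Finset.mem_image.1 he
  have := hE.2.mem t
  rw [SimpleGraph.edgeSet_fromEdgeSet] at this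
  exact this.1

/-- Extension of a map on `Fin k`. -/
def extF {V : Type*} {k : ℕ} (f : Fin k → V) (i : Fin k) (t : ℕ) : V :=
  f (if h : t < k then ⟨t, h⟩ else i)

lemma Config.congr {V : Type*} {G : SimpleGraph V} {k : ℕ} {f g : ℕ → V} {i j : ℕ}
    (h : Config G k f i j) (hfg : ∀ t < k, g t = f t) : Config G k g i j := by
  obtain ⟨h1, h2, h3, h4, h5, h6, h7, h8⟩ := h
  refine ⟨fun s t hs ht e => h1 s t hs ht ?_, fun t ht => ?_, h3, h4, h5, h6, ?_, ?_⟩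
  · rwa [← hfg s hs, ← hfg t ht]
  · rw [hfg _ (by omega), hfg _ ht]; exact h2 t ht
  · rw [hfg _ (by omega), hfg _ h4]; exact h7
  · rw [hfg _ (by omega), hfg _ (by omega)]; exact h8

open Classical in
lemma complex_config {n : ℕ} (G : SimpleGraph (Fin n)) (h : ¬ NonComplex G) :
    ∃ k ∈ Finset.range (n + 1), ∃ x : (Fin k ↪ Fin n) × Fin k × Fin k,
      Config G k (extF x.1 x.2.1) x.2.1 x.2.2 := by
  unfold NonComplex at h
  push Not at h
  obtain ⟨c, hc⟩ := h
  obtain ⟨k, hk, f, i, j, hcfg⟩ := exists_config G c.supp.toFinset (by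
    rw [Set.ncard_eq_toFinset_card', Set.ncard_eq_toFinset_card'] at hc
    refine lt_of_lt_of_eq (lt_of_eq_of_lt ?_ hc) ?_
    · congr 1
    · congr 1
      ext e
      simp [edgesIn])
  have hi : i < k := hcfg.2.2.2.1
  have hj : j < k := by have := hcfg.2.2.2.2.1; omega
  refine ⟨k, ?_, ⟨⟨fun t => f t, fun a b e => Fin.ext (hcfg.1 _ _ a.2 b.2 e)⟩, ⟨i, hi⟩, ⟨j, hj⟩⟩, ?_⟩
  · rw [Fintype.card_fin] at hk
    simpa using Nat.lt_succ_of_le hk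
  · exact hcfg.congr (fun t ht => by simp [extF, ht]; rfl)

open Classical in
lemma ucard_eq (n m : ℕ) : Ucard n m =
    (((⊤ : SimpleGraph (Fin n)).edgeFinset.powersetCard m).filter
      (fun E : Finset (Sym2 (Fin n)) =>
        NonComplex (SimpleGraph.fromEdgeSet (E : Set (Sym2 (Fin n)))))).card := by
  unfold Ucard
  rw [Nat.card_eq_fintype_card, Fintype.card_subtype]
  have hE : ∀ E : Finset (Sym2 (Fin n)), E ⊆ (⊤ : SimpleGraph (Fin n)).edgeFinset →
      (SimpleGraph.fromEdgeSet (E : Set (Sym2 (Fin n)))).edgeSet = E := by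
    intro E hE
    rw [SimpleGraph.edgeSet_fromEdgeSet]
    ext e
    simp only [Set.mem_sdiff, Finset.mem_coe, and_iff_left_iff_imp]
    intro he
    have := hE he
    simpa using this
  refine Finset.card_nbij' (fun G => G.edgeFinset)
    (fun E => SimpleGraph.fromEdgeSet (E : Set (Sym2 (Fin n)))) ?_ ?_ ?_ ?_
  · intro G hG
    simp only [Finset.coe_filter, Finset.mem_univ, true_and, Set.mem_ofPred_eq] at hG
    simp only [Finset.coe_filter, Finset.mem_powersetCard, Set.mem_ofPred_eq,
      SimpleGraph.coe_edgeFinset, SimpleGraph.fromEdgeSet_edgeSet]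
    refine ⟨⟨SimpleGraph.edgeFinset_mono le_top, ?_⟩, hG.2⟩
    rw [← hG.1, Set.ncard_eq_toFinset_card']
    rfl
  · intro E hE'
    simp only [Finset.coe_filter, Finset.mem_powersetCard, Set.mem_ofPred_eq] at hE'
    simp only [Finset.coe_filter, Finset.mem_univ, true_and, Set.mem_ofPred_eq]
    refine ⟨?_, hE'.2⟩
    rw [hE E hE'.1.1, Set.ncard_coe_finset, hE'.1.2]
  · intro G hG
    simp
  · intro E hE'
    simp only [Finset.coe_filter, Finset.mem_powersetCard, Set.mem_ofPred_eq] at hE'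
    apply Finset.coe_injective
    rw [SimpleGraph.coe_edgeFinset, hE E hE'.1.1]

open Classical in
lemma count_bound (n m : ℕ) (hm : m ≤ n.choose 2) (hN : 0 < n.choose 2) :
    Ucard n m ≤ (n.choose 2).choose m ∧
    ((n.choose 2).choose m : ℝ) - Ucard n m ≤
      ∑ k ∈ Finset.range (n + 1), ((n.descFactorial k : ℝ) * (k * k)) *
        (((m : ℝ) / (n.choose 2 : ℕ)) ^ (k + 1) * ((n.choose 2).choose m : ℝ)) := by
  have hU : (⊤ : SimpleGraph (Fin n)).edgeFinset.card = n.choose 2 := by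
    rw [SimpleGraph.card_edgeFinset_top_eq_card_choose_two, Fintype.card_fin]
  have hu := ucard_eq n m
  set U := (⊤ : SimpleGraph (Fin n)).edgeFinset with hUdef
  have hsum := Finset.card_filter_add_card_filter_not (s := U.powersetCard m)
    (fun E : Finset (Sym2 (Fin n)) =>
        NonComplex (SimpleGraph.fromEdgeSet (E : Set (Sym2 (Fin n)))))
  rw [Finset.card_powersetCard, hU, ← hu] at hsum
  refine ⟨by omega, ?_⟩
  have hsub : (U.powersetCard m).filter (fun E : Finset (Sym2 (Fin n)) =>
        ¬ NonComplex (SimpleGraph.fromEdgeSet (E : Set (Sym2 (Fin n))))) ⊆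
      (Finset.range (n + 1)).biUnion (fun k =>
        (Finset.univ : Finset ((Fin k ↪ Fin n) × Fin k × Fin k)).biUnion (fun x =>
          (U.powersetCard m).filter (fun E : Finset (Sym2 (Fin n)) =>
            Config (SimpleGraph.fromEdgeSet (E : Set (Sym2 (Fin n)))) k
              (extF x.1 x.2.1) x.2.1 x.2.2))) := by
    intro E hE
    rw [Finset.mem_filter] at hE
    obtain ⟨k, hk, x, hx⟩ := complex_config _ hE.2
    rw [Finset.mem_biUnion]
    refine ⟨k, hk, ?_⟩
    rw [Finset.mem_biUnion]
    exact ⟨x, Finset.mem_univ _, Finset.mem_filter.2 ⟨hE.1, hx⟩⟩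
  have h1 := (Finset.card_le_card hsub).trans Finset.card_biUnion_le
  rw [← hsum]
  push_cast
  rw [add_sub_cancel_left]
  refine le_trans (Nat.cast_le.2 h1) ?_
  rw [Nat.cast_sum]
  apply Finset.sum_le_sum
  intro k hk
  refine le_trans (Nat.cast_le.2 Finset.card_biUnion_le) ?_
  rw [Nat.cast_sum]
  have hNR : (0 : ℝ) < (n.choose 2 : ℕ) := by exact_mod_cast hN
  have hb : ∀ x ∈ (Finset.univ : Finset ((Fin k ↪ Fin n) × Fin k × Fin k)),
      ((((U.powersetCard m).filter (fun E : Finset (Sym2 (Fin n)) =>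
            Config (SimpleGraph.fromEdgeSet (E : Set (Sym2 (Fin n)))) k
              (extF x.1 x.2.1) x.2.1 x.2.2)).card : ℕ) : ℝ) ≤
        ((m : ℝ) / (n.choose 2 : ℕ)) ^ (k + 1) * ((n.choose 2).choose m : ℝ) := by
    intro x _
    have := card_config U m (by rw [hU]; exact hm) k (extF x.1 x.2.1) x.2.1 x.2.2
    rw [hU] at this
    have h3 : ((((U.powersetCard m).filter (fun E : Finset (Sym2 (Fin n)) =>
            Config (SimpleGraph.fromEdgeSet (E : Set (Sym2 (Fin n)))) k
              (extF x.1 x.2.1) x.2.1 x.2.2)).card : ℕ) : ℝ) * ((n.choose 2 : ℕ) : ℝ) ^ (k + 1) ≤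
        (m : ℝ) ^ (k + 1) * ((n.choose 2).choose m : ℝ) := by exact_mod_cast this
    rw [div_pow, div_mul_eq_mul_div, le_div_iff₀ (by positivity)]
    exact h3
  refine (Finset.sum_le_sum hb).trans ?_
  rw [Finset.sum_const, Finset.card_univ, Fintype.card_prod, Fintype.card_prod,
    Fintype.card_embedding_eq, Fintype.card_fin, Fintype.card_fin, nsmul_eq_mul]
  have h4 : (n.choose 2 : ℕ).choose m = Ucard n m + _ := hsum.symm
  push_cast
  rw [h4]
  push_cast
  exact le_rfl

lemma desc_le (n k : ℕ) : n.descFactorial (k + 1) ≤ n * (n - 1) ^ k := by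
  induction k with
  | zero => simp
  | succ k ih =>
    rw [Nat.descFactorial_succ, pow_succ]
    calc (n - (k + 1)) * n.descFactorial (k + 1) ≤ (n - 1) * (n * (n - 1) ^ k) :=
          Nat.mul_le_mul (by omega) ih
      _ = _ := by ring

lemma sum_sq_bound (q : ℝ) (h0 : 0 ≤ q) (h1 : q < 1) (n : ℕ) :
    ∑ k ∈ Finset.range n, ((k : ℝ) * k) * q ^ (k + 1) ≤ 2 / (1 - q) ^ 3 := by
  have hs := hasSum_choose_mul_geometric_of_norm_lt_one 2 (r := q)
    (by rw [Real.norm_eq_abs, abs_of_nonneg h0]; exact h1)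
  have h2 := sum_le_hasSum (Finset.range n) (fun i _ => by positivity) hs
  calc _ ≤ ∑ k ∈ Finset.range n, 2 * (((k + 2).choose 2 : ℝ) * q ^ k) := by
        apply Finset.sum_le_sum
        intro k _
        have e : (((k + 2).choose 2 : ℕ) : ℝ) = (k + 2) * (k + 1) / 2 := by
          rw [Nat.cast_choose_two]; push_cast; ring
        rw [e]
        have : q ^ (k + 1) ≤ q ^ k := pow_le_pow_of_le_one h0 h1.le (by omega)
        have hp : 0 ≤ q ^ k := by positivity
        have hk : (0 : ℝ) ≤ k := by positivity
        calc (k : ℝ) * k * q ^ (k + 1) ≤ (k : ℝ) * k * q ^ k := by gcongr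
          _ ≤ ((k + 2) * (k + 1)) * q ^ k := by gcongr <;> linarith
          _ = _ := by ring
    _ = 2 * ∑ k ∈ Finset.range n, (((k + 2).choose 2 : ℝ) * q ^ k) := by rw [Finset.mul_sum]
    _ ≤ 2 * (1 / (1 - q) ^ 3) := by
        have := h2
        norm_num at this ⊢
        exact this
    _ = _ := by ring

lemma ratio_bound (n m : ℕ) (hn : 3 ≤ n) (hm : 2 * m < n) :
    (Ucard n m : ℝ) / ((n.choose 2).choose m : ℝ) ≤ 1 ∧
    1 - (n : ℝ) / ((n : ℝ) - 1) ^ 2 * (2 / (1 - 2 * m / n) ^ 3) ≤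
      (Ucard n m : ℝ) / ((n.choose 2).choose m : ℝ) := by
  have hN2 : n ≤ n.choose 2 := by
    rw [Nat.choose_two_right, Nat.le_div_iff_mul_le (by norm_num)]
    exact Nat.mul_le_mul_left _ (by omega)
  have hmN : m ≤ n.choose 2 := by omega
  obtain ⟨c1, c2⟩ := count_bound n m hmN (by omega)
  have hpos : (0 : ℝ) < ((n.choose 2).choose m : ℕ) := by exact_mod_cast Nat.choose_pos hmN
  refine ⟨(div_le_one hpos).2 (by exact_mod_cast c1), ?_⟩
  have hnR : (3 : ℝ) ≤ n := by exact_mod_cast hn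
  have hmR : (2 : ℝ) * m < n := by exact_mod_cast hm
  have hterm : ∀ k ∈ Finset.range (n + 1), ((n.descFactorial k : ℝ) * (k * k)) *
        (((m : ℝ) / (n.choose 2 : ℕ)) ^ (k + 1) * ((n.choose 2).choose m : ℝ)) ≤
      ((n.choose 2).choose m : ℝ) * ((n : ℝ) / ((n : ℝ) - 1) ^ 2 *
        (((k : ℝ) * k) * (2 * m / n) ^ (k + 1))) := by
    intro k _
    rcases k with _ | k
    · simp
    have hd : (n.descFactorial (k + 1) : ℝ) ≤ n * ((n : ℝ) - 1) ^ k := by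
      have := desc_le n k
      have h' : (n.descFactorial (k + 1) : ℝ) ≤ ((n * (n - 1) ^ k : ℕ) : ℝ) := by
        exact_mod_cast this
      rw [Nat.cast_mul, Nat.cast_pow, Nat.cast_sub (by omega)] at h'
      simpa using h'
    have hn1 : (0 : ℝ) < (n : ℝ) - 1 := by linarith
    have hn0 : (0 : ℝ) < (n : ℝ) := by linarith
    have e1 : (m : ℝ) / (n.choose 2 : ℕ) = (2 * m / n) / ((n : ℝ) - 1) := by
      rw [Nat.cast_choose_two]
      field_simp
    rw [e1]
    calc _ ≤ ((n * ((n : ℝ) - 1) ^ k) * (((k + 1 : ℕ) : ℝ) * ((k + 1 : ℕ) : ℝ))) *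
        ((2 * m / n / ((n : ℝ) - 1)) ^ (k + 1 + 1) * ((n.choose 2).choose m : ℝ)) := by
          gcongr
      _ = _ := by
        rw [div_pow _ ((n : ℝ) - 1)]
        have : ((n : ℝ) - 1) ^ (k + 1 + 1) = ((n : ℝ) - 1) ^ k * ((n : ℝ) - 1) ^ 2 := by ring
        rw [this]
        have hk : ((n : ℝ) - 1) ^ k ≠ 0 := by positivity
        field_simp
  have h3 := c2.trans (Finset.sum_le_sum hterm)
  rw [← Finset.mul_sum, ← Finset.mul_sum] at h3
  have h4 := sum_sq_bound (2 * m / n) (by positivity) (by rw [div_lt_one (by linarith)]; exact hmR)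
    (n + 1)
  have h5 : (n : ℝ) / ((n : ℝ) - 1) ^ 2 *
      ∑ k ∈ Finset.range (n + 1), ((k : ℝ) * k) * (2 * m / n : ℝ) ^ (k + 1) ≤
      (n : ℝ) / ((n : ℝ) - 1) ^ 2 * (2 / (1 - 2 * m / n) ^ 3) := by gcongr
  rw [le_div_iff₀ hpos]
  have h6 := mul_le_mul_of_nonneg_left h5 hpos.le
  linarith

theorem stmt0 (m : ℕ → ℕ)
    (h : Tendsto (fun n : ℕ => ((2 * m n : ℝ) - n) / (n : ℝ) ^ ((2 : ℝ) / 3))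
      atTop atBot) :
    Tendsto (fun n : ℕ => (Ucard n (m n) : ℝ) / ((n.choose 2).choose (m n) : ℝ))
      atTop (nhds 1) := by
  set x : ℕ → ℝ := fun n : ℕ => ((2 * m n : ℝ) - n) / (n : ℝ) ^ ((2 : ℝ) / 3) with hx
  have hy : Tendsto (fun n => -x n) atTop atTop := tendsto_neg_atBot_atTop.comp h
  have hlim : Tendsto (fun n => 1 - 8 / (-x n) ^ 3) atTop (nhds 1) := by
    have h3 : Tendsto (fun n => (-x n) ^ 3) atTop atTop :=
      (tendsto_pow_atTop (by norm_num)).comp hy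
    have := (h3.const_div_atTop 8).const_sub 1
    simpa using this
  have hev : ∀ᶠ n in atTop, 3 ≤ n ∧ x n < 0 :=
    (eventually_ge_atTop 3).and (h.eventually_lt_atBot 0)
  have hmain : ∀ n, 3 ≤ n ∧ x n < 0 → 2 * m n < n := by
    rintro n ⟨hn, hxn⟩
    by_contra hcon
    have h1 : (n : ℝ) ≤ 2 * m n := by exact_mod_cast not_lt.1 hcon
    have : 0 ≤ x n := div_nonneg (by linarith) (by positivity)
    linarith
  refine tendsto_of_tendsto_of_tendsto_of_le_of_le' hlim tendsto_const_nhds ?_ ?_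
  · filter_upwards [hev] with n hn
    refine le_trans ?_ (ratio_bound n (m n) hn.1 (hmain n hn)).2
    have hnR : (3 : ℝ) ≤ n := by exact_mod_cast hn.1
    have hn0 : (0 : ℝ) < n := by linarith
    have hp : ((n : ℝ) ^ ((2 : ℝ) / 3)) ^ 3 = (n : ℝ) ^ 2 := by
      rw [← Real.rpow_natCast, ← Real.rpow_mul hn0.le]
      norm_num
    have hp0 : (0 : ℝ) < (n : ℝ) ^ ((2 : ℝ) / 3) := by positivity
    have e : (1 - 2 * (m n : ℝ) / n) ^ 3 = (-x n) ^ 3 / n := by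
      have e1 : 1 - 2 * (m n : ℝ) / n = (-x n) * (n : ℝ) ^ ((2 : ℝ) / 3) / n := by
        simp only [hx]
        field_simp
        ring
      rw [e1, div_pow, mul_pow, hp]
      field_simp
    rw [e]
    have hx3 : 0 < (-x n) ^ 3 := by
      have : 0 < -x n := by linarith [hn.2]
      positivity
    have hn1 : (0 : ℝ) < (n : ℝ) - 1 := by linarith
    have : (n : ℝ) / ((n : ℝ) - 1) ^ 2 * (2 / ((-x n) ^ 3 / n)) ≤ 8 / (-x n) ^ 3 := by
      have e2 : (n : ℝ) / ((n : ℝ) - 1) ^ 2 * (2 / ((-x n) ^ 3 / n)) =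
          (2 * (n : ℝ) ^ 2 / ((n : ℝ) - 1) ^ 2) / (-x n) ^ 3 := by
        generalize (-x n) ^ 3 = z at hx3 ⊢
        field_simp
      rw [e2]
      gcongr
      rw [div_le_iff₀ (by positivity)]
      nlinarith
    linarith
  · filter_upwards [hev] with n hn
    exact (ratio_bound n (m n) hn.1 (hmain n hn)).1
end

section
/- For every real a there exist a constant b > 0 and N ∈ ℕ such that for all n ≥ N and all m ∈ ℕ with 2m − n ≤ a·n^{2/3}, the number of graphs in 𝒰(n,m) satisfies |𝒰(n,m)| ≥ b · C(C(n,2), m). -/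
open Filter

namespace CG
open Finset
open scoped Classical

/-- indicator -/
noncomputable def ind (P : Prop) : ℝ := if P then 1 else 0

lemma ind_true {P : Prop} (h : P) : ind P = 1 := if_pos h
lemma ind_false {P : Prop} (h : ¬ P) : ind P = 0 := if_neg h
lemma ind_nonneg (P : Prop) : 0 ≤ ind P := by unfold ind; split_ifs <;> norm_num
lemma ind_le_one (P : Prop) : ind P ≤ 1 := by unfold ind; split_ifs <;> norm_num
lemma ind_mono {P Q : Prop} (h : P → Q) : ind P ≤ ind Q := by
  unfold ind; split_ifs <;> first | (exfalso; tauto) | norm_num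
lemma ind_not (P : Prop) : ind (¬ P) = 1 - ind P := by
  unfold ind; split_ifs <;> norm_num
lemma ind_or (P Q : Prop) : ind (P ∨ Q) ≤ ind P + ind Q := by
  unfold ind; split_ifs <;> first | (exfalso; tauto) | norm_num
lemma ind_and (P Q : Prop) : ind (P ∧ Q) = ind P * ind Q := by
  unfold ind; split_ifs <;> first | (exfalso; tauto) | norm_num

lemma ind_le_sum {ι : Type*} (s : Finset ι) (P : Prop) (Q : ι → Prop)
    (h : P → ∃ i ∈ s, Q i) : ind P ≤ ∑ i ∈ s, ind (Q i) := by
  by_cases hP : P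
  · obtain ⟨i, hi, hq⟩ := h hP
    rw [ind_true hP, ← ind_true hq]
    exact Finset.single_le_sum (f := fun i => ind (Q i)) (fun _ _ => ind_nonneg _) hi
  · rw [ind_false hP]
    exact Finset.sum_nonneg (fun _ _ => ind_nonneg _)

section Exp
variable {α : Type*} [DecidableEq α]

/-- expectation of `f` over a random subset of `E`, each element kept with probability `p` -/
noncomputable def Ex (p : ℝ) (E : Finset α) (f : Finset α → ℝ) : ℝ :=
  ∑ A ∈ E.powerset, p ^ #A * (1 - p) ^ #(E \ A) * f A

lemma Ex_empty (p : ℝ) (f : Finset α → ℝ) : Ex p ∅ f = f ∅ := by simp [Ex]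

lemma Ex_insert (p : ℝ) {e : α} {E : Finset α} (he : e ∉ E) (f : Finset α → ℝ) :
    Ex p (insert e E) f = (1 - p) * Ex p E f + p * Ex p E (fun A => f (insert e A)) := by
  unfold Ex
  rw [Finset.sum_powerset_insert he, Finset.mul_sum, Finset.mul_sum]
  congr 1
  · apply Finset.sum_congr rfl
    intro A hA
    rw [Finset.mem_powerset] at hA
    have : e ∉ A := fun h => he (hA h)
    rw [Finset.insert_sdiff_of_notMem _ this, Finset.card_insert_of_notMem (by simp [he])]
    ring
  · apply Finset.sum_congr rfl
    intro A hA
    rw [Finset.mem_powerset] at hA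
    have h1 : e ∉ A := fun h => he (hA h)
    have h2 : insert e E \ insert e A = E \ A := by
      ext x; simp only [Finset.mem_sdiff, Finset.mem_insert]
      constructor
      · rintro ⟨h | h, h'⟩ <;> tauto
      · rintro ⟨h, h'⟩
        refine ⟨Or.inr h, ?_⟩
        rintro (rfl | h'')
        · exact he h
        · exact h' h''
    rw [h2, Finset.card_insert_of_notMem h1]
    ring

lemma Ex_congr (p : ℝ) (E : Finset α) {f g : Finset α → ℝ} (h : ∀ A ⊆ E, f A = g A) :
    Ex p E f = Ex p E g := by
  unfold Ex
  apply Finset.sum_congr rfl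
  intro A hA
  rw [h A (Finset.mem_powerset.1 hA)]

lemma Ex_mono {p : ℝ} (hp : 0 ≤ p) (hp1 : p ≤ 1) (E : Finset α) {f g : Finset α → ℝ}
    (h : ∀ A ⊆ E, f A ≤ g A) : Ex p E f ≤ Ex p E g := by
  unfold Ex
  apply Finset.sum_le_sum
  intro A hA
  have : 0 ≤ 1 - p := by linarith
  exact mul_le_mul_of_nonneg_left (h A (Finset.mem_powerset.1 hA)) (by positivity)

lemma Ex_const (p : ℝ) (E : Finset α) (c : ℝ) : Ex p E (fun _ => c) = c := by
  induction E using Finset.induction_on with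
  | empty => simp [Ex_empty]
  | insert e E he ih => rw [Ex_insert p he, ih]; ring

lemma Ex_add (p : ℝ) (E : Finset α) (f g : Finset α → ℝ) :
    Ex p E (fun A => f A + g A) = Ex p E f + Ex p E g := by
  unfold Ex; rw [← Finset.sum_add_distrib]; apply Finset.sum_congr rfl; intros; ring

lemma Ex_sub (p : ℝ) (E : Finset α) (f g : Finset α → ℝ) :
    Ex p E (fun A => f A - g A) = Ex p E f - Ex p E g := by
  unfold Ex; rw [← Finset.sum_sub_distrib]; apply Finset.sum_congr rfl; intros; ring

lemma Ex_mul (p : ℝ) (E : Finset α) (c : ℝ) (f : Finset α → ℝ) :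
    Ex p E (fun A => c * f A) = c * Ex p E f := by
  unfold Ex; rw [Finset.mul_sum]; apply Finset.sum_congr rfl; intros; ring

lemma Ex_sum {ι : Type*} (p : ℝ) (E : Finset α) (s : Finset ι) (f : ι → Finset α → ℝ) :
    Ex p E (fun A => ∑ i ∈ s, f i A) = ∑ i ∈ s, Ex p E (f i) := by
  unfold Ex; rw [Finset.sum_comm]; apply Finset.sum_congr rfl; intros; rw [Finset.mul_sum]

lemma Ex_nonneg {p : ℝ} (hp : 0 ≤ p) (hp1 : p ≤ 1) (E : Finset α) {f : Finset α → ℝ}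
    (h : ∀ A ⊆ E, 0 ≤ f A) : 0 ≤ Ex p E f := by
  have := Ex_mono hp hp1 E (f := fun _ => 0) (g := f) h
  rwa [Ex_const] at this

lemma Ex_union (p : ℝ) (E₁ E₂ : Finset α) (hd : Disjoint E₁ E₂) (f : Finset α → ℝ) :
    Ex p (E₁ ∪ E₂) f = Ex p E₁ (fun A => Ex p E₂ (fun B => f (A ∪ B))) := by
  induction E₁ using Finset.induction_on generalizing f with
  | empty => simp [Ex_empty]
  | insert e E he ih =>
    rw [Finset.disjoint_insert_left] at hd
    rw [Finset.insert_union, Ex_insert p (by simp [he, hd.1]), Ex_insert p he, ih hd.2, ih hd.2]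
    simp only [Finset.insert_union]

/-- marginals -/
lemma Ex_marginal (p : ℝ) {E' E : Finset α} (h : E' ⊆ E) (f : Finset α → ℝ)
    (hf : ∀ A ⊆ E, f A = f (A ∩ E')) : Ex p E f = Ex p E' f := by
  have h1 : E' ∪ (E \ E') = E := Finset.union_sdiff_of_subset h
  rw [← h1, Ex_union p _ _ Finset.disjoint_sdiff]
  apply Ex_congr
  intro A hA
  rw [← Ex_const p (E \ E') (f A)]
  apply Ex_congr
  intro B hB
  rw [hf _ (Finset.union_subset (hA.trans h) (hB.trans Finset.sdiff_subset))]
  congr 1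
  ext x
  have := @hA x
  have := @hB x
  simp only [Finset.mem_inter, Finset.mem_union, Finset.mem_sdiff] at *
  tauto

lemma Ex_subset_mul (p : ℝ) {B E : Finset α} (h : B ⊆ E) (f : Finset α → ℝ)
    (hf : ∀ A ⊆ E, f A = f (A \ B)) :
    Ex p E (fun A => ind (B ⊆ A) * f A) = p ^ #B * Ex p E f := by
  induction B using Finset.induction_on generalizing E f with
  | empty => simp [ind_true]
  | insert b B hb ih =>
    have hbE : b ∈ E := h (Finset.mem_insert_self _ _)
    obtain ⟨E, hbE', rfl⟩ : ∃ F, b ∉ F ∧ insert b F = E :=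
      ⟨E.erase b, by simp, Finset.insert_erase hbE⟩
    have hBE : B ⊆ E := by
      intro x hx
      have := h (Finset.mem_insert_of_mem hx)
      rw [Finset.mem_insert] at this
      rcases this with rfl | h'
      · exact absurd hx hb
      · exact h'
    have hfi : ∀ A ⊆ E, f (insert b A) = f A := by
      intro A hA
      rw [hf _ (Finset.insert_subset_insert _ hA), hf A (hA.trans (Finset.subset_insert _ _))]
      congr 1
      ext x; simp only [Finset.mem_sdiff, Finset.mem_insert]; tauto
    rw [Ex_insert p hbE', Ex_insert p hbE', Finset.card_insert_of_notMem hb]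
    have e1 : Ex p E (fun A => ind (insert b B ⊆ A) * f A) = 0 := by
      rw [← Ex_const p E 0]
      apply Ex_congr
      intro A hA
      rw [ind_false, zero_mul]
      intro h'
      exact hbE' (hA (h' (Finset.mem_insert_self _ _)))
    have e2 : Ex p E (fun A => ind (insert b B ⊆ insert b A) * f (insert b A))
        = Ex p E (fun A => ind (B ⊆ A) * f A) := by
      apply Ex_congr
      intro A hA
      rw [hfi A hA]
      congr 2
      apply propext
      constructor
      · intro h' x hx
        have := h' (Finset.mem_insert_of_mem hx)
        rw [Finset.mem_insert] at this
        rcases this with rfl | h''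
        · exact absurd hx hb
        · exact h''
      · exact Finset.insert_subset_insert _
    have e3 : Ex p E (fun A => f (insert b A)) = Ex p E f := Ex_congr p E hfi
    rw [e1, e2, e3, ih hBE]
    · ring
    · intro A hA
      rw [hf A (hA.trans (Finset.subset_insert _ _)),
        hf (A \ B) ((Finset.sdiff_subset.trans hA).trans (Finset.subset_insert _ _))]
      congr 1
      ext x; simp only [Finset.mem_sdiff, Finset.mem_insert]; tauto

lemma Ex_subset_le {p : ℝ} (hp : 0 ≤ p) (B E : Finset α) :
    Ex p E (fun A => ind (B ⊆ A)) ≤ p ^ #B := by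
  by_cases h : B ⊆ E
  · have := Ex_subset_mul p h (fun _ => 1) (fun _ _ => rfl)
    simp only [mul_one, Ex_const] at this
    exact this.le
  · have : Ex p E (fun A => ind (B ⊆ A)) = Ex p E (fun _ => 0) := by
      apply Ex_congr; intro A hA
      exact ind_false (fun h' => h (h'.trans hA))
    rw [this, Ex_const]; positivity

lemma Ex_pow_card (p x : ℝ) (E : Finset α) :
    Ex p E (fun A => x ^ #A) = (1 - p + p * x) ^ #E := by
  induction E using Finset.induction_on with
  | empty => simp [Ex_empty]
  | insert e E he ih =>
    rw [Ex_insert p he, ih, Finset.card_insert_of_notMem he]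
    have : Ex p E (fun A => x ^ #(insert e A)) = Ex p E (fun A => x * x ^ #A) := by
      apply Ex_congr; intro A hA
      rw [Finset.card_insert_of_notMem (fun h => he (hA h))]; ring
    rw [this, Ex_mul, ih]; ring

/-- Harris inequality for antitone functions -/
lemma harris {p : ℝ} (hp : 0 ≤ p) (hp1 : p ≤ 1) (E : Finset α) (f g : Finset α → ℝ)
    (hf : Antitone f) (hg : Antitone g) :
    Ex p E f * Ex p E g ≤ Ex p E (fun A => f A * g A) := by
  induction E using Finset.induction_on generalizing f g with
  | empty => simp [Ex_empty]
  | insert e E he ih =>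
    rw [Ex_insert p he, Ex_insert p he, Ex_insert p he]
    have hf1 : Antitone (fun A => f (insert e A)) :=
      fun A B h => hf (Finset.insert_subset_insert _ h)
    have hg1 : Antitone (fun A => g (insert e A)) :=
      fun A B h => hg (Finset.insert_subset_insert _ h)
    have i1 := ih f g hf hg
    have i2 := ih _ _ hf1 hg1
    have j1 : Ex p E (fun A => f (insert e A)) ≤ Ex p E f :=
      Ex_mono hp hp1 E (fun A _ => hf (Finset.subset_insert _ _))
    have j2 : Ex p E (fun A => g (insert e A)) ≤ Ex p E g :=
      Ex_mono hp hp1 E (fun A _ => hg (Finset.subset_insert _ _))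
    have k : 0 ≤ p * (1 - p) * ((Ex p E f - Ex p E (fun A => f (insert e A))) *
        (Ex p E g - Ex p E (fun A => g (insert e A)))) := by
      apply mul_nonneg (mul_nonneg hp (by linarith))
      exact mul_nonneg (by linarith) (by linarith)
    have l1 := mul_le_mul_of_nonneg_left i1 (show 0 ≤ 1 - p by linarith)
    have l2 := mul_le_mul_of_nonneg_left i2 hp
    nlinarith

lemma harris_prod {ι : Type*} {p q : ℝ} (hp : 0 ≤ p) (hp1 : p ≤ 1) (hq : 0 ≤ q) (E : Finset α)
    (s : Finset ι) (P : ι → Finset α → Prop)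
    (hP : ∀ i ∈ s, ∀ A B, A ⊆ B → P i B → P i A)
    (hq' : ∀ i ∈ s, q ≤ Ex p E (fun A => ind (P i A))) :
    q ^ #s ≤ Ex p E (fun A => ind (∀ i ∈ s, P i A)) := by
  induction s using Finset.induction_on with
  | empty =>
    have : Ex p E (fun A => ind (∀ i ∈ (∅ : Finset ι), P i A)) = Ex p E (fun _ => 1) := by
      apply Ex_congr; intro A hA; exact ind_true (by simp)
    rw [this, Ex_const]; simp
  | insert i s hi ih =>
    have ih' := ih (fun j hj => hP j (Finset.mem_insert_of_mem hj))
      (fun j hj => hq' j (Finset.mem_insert_of_mem hj))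
    have : Ex p E (fun A => ind (∀ j ∈ insert i s, P j A))
        = Ex p E (fun A => ind (P i A) * ind (∀ j ∈ s, P j A)) := by
      apply Ex_congr; intro A hA
      rw [← ind_and]; congr 1; simp
    rw [this, Finset.card_insert_of_notMem hi, pow_succ']
    refine le_trans ?_ (harris hp hp1 E _ _ ?_ ?_)
    · exact mul_le_mul (hq' i (Finset.mem_insert_self _ _)) ih' (by positivity)
        (hq.trans (hq' i (Finset.mem_insert_self _ _)))
    · intro A B h
      exact ind_mono (hP i (Finset.mem_insert_self _ _) A B h)
    · intro A B h
      exact ind_mono (fun h' j hj => hP j (Finset.mem_insert_of_mem hj) A B h (h' j hj))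

end Exp
end CG

namespace CG
open Finset
open scoped Classical
section Hp
variable {V : Type*} [DecidableEq V]

/-- all possible edges on `S` -/
noncomputable def pairs (S : Finset V) : Finset (Sym2 V) := S.sym2.filter (fun e => ¬ e.IsDiag)

lemma mem_pairs {S : Finset V} {a b : V} : s(a, b) ∈ pairs S ↔ a ∈ S ∧ b ∈ S ∧ a ≠ b := by
  simp [pairs, and_assoc]

lemma pairs_mono {S T : Finset V} (h : S ⊆ T) : pairs S ⊆ pairs T := by
  intro e
  induction e with | _ a b => ?_
  rw [mem_pairs, mem_pairs]
  exact fun ⟨h1, h2, h3⟩ => ⟨h h1, h h2, h3⟩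

/-- there is a path with `k` edges from `v` whose other vertices lie in `S` -/
def hp (A : Finset (Sym2 V)) : ℕ → Finset V → V → Prop
  | 0, _, _ => True
  | k + 1, S, v => ∃ w ∈ S, s(v, w) ∈ A ∧ hp A k (S.erase w) w

lemma hp_mono {A B : Finset (Sym2 V)} (k : ℕ) : ∀ (S T : Finset V) (v : V), v ∉ S → S ⊆ T →
    (∀ e ∈ A, e ∈ (insert v S).sym2 → e ∈ B) → hp A k S v → hp B k T v := by
  induction k with
  | zero => intros; trivial
  | succ k ih =>
    rintro S T v hv hST hAB ⟨w, hw, hvw, h⟩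
    refine ⟨w, hST hw, hAB _ hvw ?_, ih (S.erase w) (T.erase w) w (by simp)
      (Finset.erase_subset_erase _ hST) ?_ h⟩
    · simp [hw]
    · intro e he he'
      apply hAB e he
      rw [Finset.insert_erase hw] at he'
      exact Finset.sym2_mono (Finset.subset_insert _ _) he'

noncomputable def star (v : V) (S : Finset V) : Finset (Sym2 V) := S.image (fun w => s(v, w))

lemma mem_star {v w : V} {S : Finset V} : s(v, w) ∈ star v S ↔ w ∈ S := by
  unfold star
  rw [Finset.mem_image]
  constructor
  · rintro ⟨x, hx, h⟩
    rw [Sym2.congr_right] at h; rwa [← h]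
  · intro h; exact ⟨w, h, rfl⟩

lemma card_star (v : V) (S : Finset V) : #(star v S) = #S :=
  Finset.card_image_of_injective _ (fun a b h => Sym2.congr_right.1 h)

lemma pairs_insert {v : V} {S : Finset V} (hv : v ∉ S) :
    pairs (insert v S) = star v S ∪ pairs S := by
  ext e
  induction e with | _ a b => ?_
  rw [Finset.mem_union, mem_pairs, mem_pairs]
  constructor
  · rintro ⟨h1, h2, h3⟩
    rw [Finset.mem_insert] at h1 h2
    rcases h1 with rfl | h1
    · rcases h2 with rfl | h2
      · exact absurd rfl h3
      · left; exact mem_star.2 h2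
    · rcases h2 with rfl | h2
      · left; rw [Sym2.eq_swap]; exact mem_star.2 h1
      · right; exact ⟨h1, h2, h3⟩
  · rintro (h | ⟨h1, h2, h3⟩)
    · simp only [star, Finset.mem_image] at h
      obtain ⟨w, hw, h⟩ := h
      have hvw : v ≠ w := by rintro rfl; exact hv hw
      rw [Sym2.eq_iff] at h
      rcases h with ⟨rfl, rfl⟩ | ⟨rfl, rfl⟩
      · exact ⟨by simp, by simp [hw], hvw⟩
      · exact ⟨by simp [hw], by simp, hvw.symm⟩
    · exact ⟨by simp [h1], by simp [h2], h3⟩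

lemma disj_star {v : V} {S : Finset V} (hv : v ∉ S) : Disjoint (star v S) (pairs S) := by
  rw [Finset.disjoint_left]
  intro e h h'
  simp only [star, Finset.mem_image] at h
  obtain ⟨w, hw, rfl⟩ := h
  exact hv (mem_pairs.1 h').1

noncomputable def Q (p : ℝ) (n : ℕ) : ℕ → ℝ
  | 0 => 1
  | k + 1 => 1 - (1 - p * Q p n k) ^ n

lemma Q_mem {p : ℝ} (hp : 0 ≤ p) (hp1 : p ≤ 1) (n k : ℕ) : 0 ≤ Q p n k ∧ Q p n k ≤ 1 := by
  induction k with
  | zero => simp [Q]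
  | succ k ih =>
    have h1 : 0 ≤ 1 - p * Q p n k := by nlinarith [ih.1, ih.2]
    have h2 : 1 - p * Q p n k ≤ 1 := by nlinarith [ih.1, ih.2]
    have h3 := pow_le_one₀ h1 h2 (n := n)
    have h4 := pow_nonneg h1 n
    simp only [Q]
    constructor <;> linarith

lemma hp_prob {p : ℝ} (hp0 : 0 ≤ p) (hp1 : p ≤ 1) (n k : ℕ) : ∀ (S : Finset V) (v : V), v ∉ S →
    #S ≤ n → Ex p (pairs (insert v S)) (fun A => ind (hp A k S v)) ≤ Q p n k := by
  induction k with
  | zero =>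
    intro S v hv hS
    calc _ ≤ Ex p (pairs (insert v S)) (fun _ => 1) :=
          Ex_mono hp0 hp1 _ (fun A _ => ind_le_one _)
      _ = 1 := Ex_const _ _ _
      _ = _ := rfl
  | succ k ih =>
    intro S v hv hS
    obtain ⟨q0, q1⟩ := Q_mem hp0 hp1 n k
    rw [pairs_insert hv, Ex_union p _ _ (disj_star hv)]
    have key : ∀ A ⊆ star v S, (1 - Q p n k) ^ #A ≤
        Ex p (pairs S) (fun B => 1 - ind (hp (A ∪ B) (k+1) S v)) := by
      intro A hA
      set W := S.filter (fun w => s(v, w) ∈ A) with hW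
      have hAW : star v W = A := by
        ext e
        simp only [star, Finset.mem_image, hW, Finset.mem_filter]
        constructor
        · rintro ⟨w, ⟨_, h⟩, rfl⟩; exact h
        · intro h
          have h' := hA h
          simp only [star, Finset.mem_image] at h'
          obtain ⟨w, hw, rfl⟩ := h'
          exact ⟨w, ⟨hw, h⟩, rfl⟩
      have hc : #A = #W := by rw [← card_star v W, hAW]
      rw [hc]
      refine (harris_prod hp0 hp1 (by linarith) (pairs S) W
        (fun w B => ¬ hp B k (S.erase w) w) ?_ ?_).trans ?_
      · intro w hw B C hBC h h'
        exact h (hp_mono k _ _ w (by simp) subset_rfl (fun e he _ => hBC he) h')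
      · intro w hw
        have hwS : w ∈ S := (Finset.mem_filter.1 hw).1
        have := ih (S.erase w) w (by simp) ((Finset.card_erase_le).trans hS)
        rw [Finset.insert_erase hwS] at this
        simp only [ind_not]
        rw [Ex_sub, Ex_const]; linarith
      · apply Ex_mono hp0 hp1
        intro B hB
        rw [← ind_not]
        apply ind_mono
        rintro h ⟨w, hw, hvw, h'⟩
        have hwA : s(v, w) ∈ A := by
          rcases Finset.mem_union.1 hvw with h1 | h1
          · exact h1
          · exact absurd (mem_pairs.1 (hB h1)).1 hv
        refine h w (Finset.mem_filter.2 ⟨hw, hwA⟩) (hp_mono k _ _ w (by simp) subset_rfl ?_ h')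
        intro e he he'
        rw [Finset.insert_erase hw] at he'
        rcases Finset.mem_union.1 he with h1 | h1
        · exfalso
          have := hA h1
          simp only [star, Finset.mem_image] at this
          obtain ⟨x, hx, rfl⟩ := this
          exact hv (Finset.mk_mem_sym2_iff.1 he').1
        · exact h1
    have k2 := Ex_mono hp0 hp1 (star v S) key
    rw [Ex_pow_card, card_star] at k2
    simp only [Ex_sub, Ex_const] at k2
    have e : 1 - p + p * (1 - Q p n k) = 1 - p * Q p n k := by ring
    rw [e] at k2
    have hb0 : 0 ≤ 1 - p * Q p n k := by nlinarith
    have hb1 : 1 - p * Q p n k ≤ 1 := by nlinarith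
    have := pow_le_pow_of_le_one hb0 hb1 hS
    simp only [Q]
    linarith

lemma exp_frac (y : ℝ) (h0 : 0 ≤ y) (h1 : y ≤ 3/2) :
    1 - Real.exp (-y) ≤ y / (1 + y / 3) := by
  have h2 : |(-(y/2))| ≤ 1 := by rw [abs_neg, abs_of_nonneg (by linarith)]; linarith
  have := Real.exp_bound h2 (n := 3) (by norm_num)
  rw [abs_neg, abs_of_nonneg (by linarith : (0:ℝ) ≤ y/2)] at this
  simp [Finset.sum_range_succ, Nat.factorial] at this
  have h3 := (abs_le.1 this).1
  set z := Real.exp (-(y/2)) with hz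
  have hzz : Real.exp (-y) = z ^ 2 := by rw [hz, ← Real.exp_nat_mul]; congr 1; push_cast; ring
  rw [hzz, le_div_iff₀ (by linarith)]
  set x := y / 2 with hx
  have hy : y = 2 * x := by rw [hx]; ring
  have hx0 : 0 ≤ x := by linarith
  have hx1 : x ≤ 3/4 := by linarith
  have hL : 1 - x + x^2/2 - 2/9 * x^3 ≤ z := by
    have : ((-x)^2 = x^2) := by ring
    nlinarith
  have hL0 : 0 ≤ 1 - x + x^2/2 - 2/9 * x^3 := by nlinarith [sq_nonneg x, mul_nonneg hx0 hx0]
  have hz2 : (1 - x + x^2/2 - 2/9 * x^3)^2 ≤ z^2 := pow_le_pow_left₀ hL0 hL 2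
  rw [hy]
  have : (1 - (1 - x + x^2/2 - 2/9 * x^3)^2) * (1 + 2*x/3) ≤ 2 * x := by
    have hpoly : 2 * x - (1 - (1 - x + x^2/2 - 2/9 * x^3)^2) * (1 + 2*x/3)
       = x^2 * (2/3 - 1/9 * x - x^2 * (29/108) + x^3*(13/54) - x^4 * (8/81) + x^5*(8/243)) := by
      ring
    have : 0 ≤ x^2 * (2/3 - 1/9 * x - x^2 * (29/108) + x^3*(13/54) - x^4 * (8/81) + x^5*(8/243)) := by
      have a2 : x^2 ≤ 9/16 := by nlinarith
      have a4 : x^4 ≤ 1 := pow_le_one₀ hx0 (by linarith)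
      have a3 : 0 ≤ x^3 := by positivity
      have a5 : 0 ≤ x^5 := by positivity
      apply mul_nonneg (by positivity)
      linarith
    linarith
  nlinarith

lemma Q_bound {p θ : ℝ} (n : ℕ) (hp0 : 0 ≤ p) (hp1 : p < 1) (h1 : 1 ≤ θ) (h2 : θ ≤ 3/2)
    (hθ : n * p ≤ θ * (1 - p)) (k : ℕ) : k * Q p n k ≤ 3 * θ ^ k := by
  induction k with
  | zero => simp
  | succ k ih =>
    obtain ⟨q0, q1⟩ := Q_mem hp0 hp1.le n k
    set q := Q p n k with hq
    have hx0 : 0 ≤ p * q := by positivity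
    have hx1 : p * q ≤ p := by nlinarith
    have hx2 : 0 < 1 - p * q := by linarith
    have e1 : Real.exp (-(p * q / (1 - p * q))) ≤ 1 - p * q := by
      rw [Real.exp_neg, inv_le_comm₀ (Real.exp_pos _) hx2]
      calc (1 - p * q)⁻¹ = p * q / (1 - p * q) + 1 := by field_simp; ring
        _ ≤ _ := Real.add_one_le_exp _
    have e2 : Real.exp (-(θ * q)) ≤ (1 - p * q) ^ n := by
      calc Real.exp (-(θ * q)) ≤ Real.exp (n * (-(p * q / (1 - p * q)))) := by
            apply Real.exp_le_exp.2
            have : n * (p * q / (1 - p * q)) ≤ θ * q := by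
              rw [← mul_div_assoc, div_le_iff₀ hx2]
              nlinarith [mul_le_mul_of_nonneg_right hθ q0, mul_le_mul_of_nonneg_left hx1 (by positivity : 0 ≤ θ * q)]
            linarith
        _ = Real.exp (-(p * q / (1 - p * q))) ^ n := by rw [Real.exp_nat_mul]
        _ ≤ _ := pow_le_pow_left₀ (Real.exp_pos _).le e1 n
    have e3 := exp_frac (θ * q) (by positivity) (by nlinarith)
    have e4 : Q p n (k+1) ≤ θ * q / (1 + θ * q / 3) := by
      have : Q p n (k+1) = 1 - (1 - p * q) ^ n := rfl
      linarith
    have hpos : 0 < 1 + θ * q / 3 := by positivity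
    rw [le_div_iff₀ hpos] at e4
    have e5 : 1 ≤ θ ^ (k+1) := one_le_pow₀ h1
    have e6 : ((k:ℝ)+1) * (Q p n (k+1) * (1 + θ * q / 3)) ≤ 3 * θ ^ (k+1) * (1 + θ * q / 3) := by
      have g1 : ((k:ℝ)+1) * (Q p n (k+1) * (1 + θ * q / 3)) ≤ ((k:ℝ)+1) * (θ * q) :=
        mul_le_mul_of_nonneg_left e4 (by positivity)
      have g2 : θ * (k * q) ≤ θ * (3 * θ ^ k) := mul_le_mul_of_nonneg_left ih (by positivity)
      have g3 : 1 * (θ * q) ≤ θ ^ (k+1) * (θ * q) := mul_le_mul_of_nonneg_right e5 (by positivity)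
      rw [pow_succ] at *
      nlinarith
    push_cast
    have e7 : (((k:ℝ)+1) * Q p n (k+1)) * (1 + θ * q / 3) ≤ 3 * θ ^ (k+1) * (1 + θ * q / 3) := by
      linarith
    exact le_of_mul_le_mul_right e7 hpos

end Hp
end CG

namespace CG
open Finset
open scoped Classical
section Rec
variable {V : Type*} [DecidableEq V]

/-- no complex component -/
def NC (A : Finset (Sym2 V)) : Prop := ∀ T : Finset V, #(A ∩ T.sym2) ≤ #T

/-- `A` is a forest on `S` -/
def TreeOn (A : Finset (Sym2 V)) (S : Finset V) : Prop :=
  ∀ T ⊆ S, T.Nonempty → #(A ∩ T.sym2) < #T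

lemma TreeOn.nc {A : Finset (Sym2 V)} {S : Finset V} (h : TreeOn A S) : NC (A ∩ S.sym2) := by
  intro T
  have h1 : A ∩ S.sym2 ∩ T.sym2 ⊆ A ∩ (T ∩ S).sym2 := by
    intro e
    induction e with | _ a b => ?_
    simp only [Finset.mem_inter, Finset.mk_mem_sym2_iff]
    tauto
  have h2 : #(T ∩ S) ≤ #T := Finset.card_le_card Finset.inter_subset_left
  rcases (T ∩ S).eq_empty_or_nonempty with h3 | h3
  · rw [h3] at h1
    have := Finset.card_le_card h1
    simp at this
    simp [this]
  · have := h (T ∩ S) Finset.inter_subset_right h3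
    have := Finset.card_le_card h1
    omega

/-- reachability -/
def Reach (A : Finset (Sym2 V)) (v w : V) : Prop :=
  Relation.ReflTransGen (fun a b => s(a, b) ∈ A) v w

variable [Fintype V]

/-- component of `v` -/
noncomputable def Comp (A : Finset (Sym2 V)) (v : V) : Finset V := Finset.univ.filter (Reach A v)

lemma mem_Comp {A : Finset (Sym2 V)} {v w : V} : w ∈ Comp A v ↔ Reach A v w := by simp [Comp]

lemma self_mem_Comp (A : Finset (Sym2 V)) (v : V) : v ∈ Comp A v :=
  mem_Comp.2 Relation.ReflTransGen.refl

lemma Comp_edge {A : Finset (Sym2 V)} {v x y : V} (h : s(x, y) ∈ A) :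
    x ∈ Comp A v ↔ y ∈ Comp A v := by
  rw [mem_Comp, mem_Comp]
  exact ⟨fun h' => h'.tail h, fun h' => h'.tail (by rwa [Sym2.eq_swap])⟩

lemma Comp_subset {A : Finset (Sym2 V)} {V0 : Finset V} {v : V} (hv : v ∈ V0)
    (hA : A ⊆ pairs V0) : Comp A v ⊆ V0 := by
  intro w hw
  rw [mem_Comp] at hw
  induction hw with
  | refl => exact hv
  | tail _ h _ => exact (mem_pairs.1 (hA h)).2.1

lemma Comp_congr {A B : Finset (Sym2 V)} {v : V} {S : Finset V}
    (h : ∀ x ∈ S, ∀ y, s(x, y) ∈ A ↔ s(x, y) ∈ B) (hS : Comp A v = S) : Comp B v = S := by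
  subst hS
  ext w
  rw [mem_Comp, mem_Comp]
  constructor
  · intro hw
    induction hw with
    | refl => exact Relation.ReflTransGen.refl
    | tail _ hxy ih => exact ih.tail ((h _ (mem_Comp.2 ih) _).2 hxy)
  · intro hw
    induction hw with
    | refl => exact Relation.ReflTransGen.refl
    | tail hx hxy ih => exact ih.tail ((h _ (mem_Comp.2 hx) _).1 hxy)

lemma rec_term {p : ℝ} (hp0 : 0 ≤ p) (hp1 : p ≤ 1) (V0 S : Finset V) (v : V) :
    Ex p (pairs V0) (fun A => ind (Comp A v = S ∧ NC (A ∩ S.sym2))) *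
      Ex p (pairs (V0 \ S)) (fun A => ind (NC A)) ≤
    Ex p (pairs V0) (fun A => ind (Comp A v = S) * ind (NC A)) := by
  set D := pairs (V0 \ S) with hD
  set F := pairs V0 \ D with hF
  have hDE : D ⊆ pairs V0 := pairs_mono Finset.sdiff_subset
  have hFD : F ∪ D = pairs V0 := Finset.sdiff_union_of_subset hDE
  have hdis : Disjoint F D := Finset.sdiff_disjoint
  have hDS : ∀ x ∈ S, ∀ y, s(x, y) ∉ D := by
    intro x hx y h
    have := (mem_pairs.1 h).1
    simp [hx] at this
  have key : ∀ A : Finset (Sym2 V), A ⊆ pairs V0 → ∀ x ∈ S, ∀ y, s(x, y) ∈ A ↔ s(x, y) ∈ A ∩ F := by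
    intro A hA x hx y
    rw [Finset.mem_inter, hF, Finset.mem_sdiff]
    exact ⟨fun h => ⟨h, hA h, hDS x hx y⟩, fun h => h.1⟩
  have hinter : ∀ A : Finset (Sym2 V), A ⊆ pairs V0 → A ∩ S.sym2 = (A ∩ F) ∩ S.sym2 := by
    intro A hA
    ext e
    induction e with | _ a b => ?_
    rw [Finset.mem_inter, Finset.mem_inter, Finset.mk_mem_sym2_iff]
    constructor
    · rintro ⟨h1, h2, h3⟩; exact ⟨(key A hA a h2 b).1 h1, h2, h3⟩
    · rintro ⟨h1, h2, h3⟩; exact ⟨(key A hA a h2 b).2 h1, h2, h3⟩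
  have hcomp : ∀ A : Finset (Sym2 V), A ⊆ pairs V0 → (Comp A v = S ↔ Comp (A ∩ F) v = S) := by
    intro A hA
    exact ⟨Comp_congr (key A hA), Comp_congr (fun x hx y => (key A hA x hx y).symm)⟩
  rw [Ex_marginal p (E' := F) (E := pairs V0) Finset.sdiff_subset]
  · rw [← hFD, Ex_union p _ _ hdis, mul_comm, ← Ex_mul]
    apply Ex_mono hp0 hp1
    intro A1 hA1
    rw [mul_comm, ← Ex_mul]
    apply Ex_mono hp0 hp1
    intro A2 hA2
    have hA : A1 ∪ A2 ⊆ pairs V0 := hFD ▸ Finset.union_subset_union hA1 hA2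
    have hAF : (A1 ∪ A2) ∩ F = A1 := by
      ext e
      have := @hA1 e
      have := @hA2 e
      have h9 : e ∈ F → e ∉ D := fun h => Finset.disjoint_left.1 hdis h
      simp only [Finset.mem_inter, Finset.mem_union]
      tauto
    rw [← ind_and, ← ind_and]
    apply ind_mono
    rintro ⟨⟨h1, h2⟩, h3⟩
    have h1' : Comp (A1 ∪ A2) v = S := (hcomp _ hA).2 (by rwa [hAF])
    refine ⟨h1', ?_⟩
    intro T
    have hsub : (A1 ∪ A2) ∩ T.sym2 ⊆ ((A1 ∩ S.sym2) ∩ (T ∩ S).sym2) ∪ (A2 ∩ (T \ S).sym2) := by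
      intro e
      induction e with | _ a b => ?_
      intro he
      rw [Finset.mem_inter, Finset.mk_mem_sym2_iff] at he
      obtain ⟨he, ha, hb⟩ := he
      have hab := Comp_edge (v := v) he
      rw [h1'] at hab
      by_cases haS : a ∈ S
      · have hbS := hab.1 haS
        have := (key _ hA a haS b).1 he
        rw [hAF] at this
        simp [*]
      · have hbS : b ∉ S := fun h => haS (hab.2 h)
        have h5 := mem_pairs.1 (hA he)
        have h6 : s(a, b) ∈ D := mem_pairs.2 (by simp [*])
        have h7 : s(a, b) ∈ A2 := by
          rcases Finset.mem_union.1 he with h | h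
          · exact absurd h6 (Finset.disjoint_left.1 hdis (hA1 h))
          · exact h
        simp [*]
    calc #((A1 ∪ A2) ∩ T.sym2) ≤ _ := Finset.card_le_card hsub
      _ ≤ _ := Finset.card_union_le _ _
      _ ≤ #(T ∩ S) + #(T \ S) := add_le_add (h2 _) (h3 _)
      _ = #T := Finset.card_inter_add_card_sdiff T S
  · intro A hA
    congr 1
    rw [← hinter A hA]
    rw [hcomp A hA]

/-- good exploration -/
def Good (A : Finset (Sym2 V)) (v : V) (K : ℝ) : Prop :=
  TreeOn A (Comp A v) ∧ (#(Comp A v) : ℝ) ≤ K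

lemma recursion {p : ℝ} (hp0 : 0 ≤ p) (hp1 : p ≤ 1) (V0 : Finset V) (v : V) (hv : v ∈ V0)
    (K : ℝ) (ψ : ℕ → ℝ) (hψ : ∀ k, 0 ≤ ψ k)
    (h : ∀ S ⊆ V0, v ∈ S → (#S : ℝ) ≤ K → ψ #S ≤ Ex p (pairs (V0 \ S)) (fun A => ind (NC A))) :
    Ex p (pairs V0) (fun A => ind (Good A v K) * ψ #(Comp A v)) ≤
      Ex p (pairs V0) (fun A => ind (NC A)) := by
  have part : ∀ (A : Finset (Sym2 V)) (x : ℝ), x = ∑ S : Finset V, ind (Comp A v = S) * x := by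
    intro A x
    rw [Finset.sum_eq_single (Comp A v)]
    · rw [ind_true rfl, one_mul]
    · intro S _ hS
      rw [ind_false (fun h => hS h.symm), zero_mul]
    · simp
  calc Ex p (pairs V0) (fun A => ind (Good A v K) * ψ #(Comp A v))
      = Ex p (pairs V0) (fun A => ∑ S : Finset V, ind (Comp A v = S) *
          (ind (Good A v K) * ψ #(Comp A v))) := Ex_congr _ _ (fun A _ => part A _)
    _ = ∑ S : Finset V, Ex p (pairs V0) (fun A => ind (Comp A v = S) *
          (ind (Good A v K) * ψ #(Comp A v))) := Ex_sum _ _ _ _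
    _ ≤ ∑ S : Finset V, Ex p (pairs V0) (fun A => ind (Comp A v = S) * ind (NC A)) := by
        apply Finset.sum_le_sum
        intro S _
        by_cases hS : S ⊆ V0 ∧ v ∈ S ∧ (#S : ℝ) ≤ K
        · refine le_trans ?_ (rec_term hp0 hp1 V0 S v)
          have h0 : 0 ≤ Ex p (pairs V0) (fun A => ind (Comp A v = S ∧ NC (A ∩ S.sym2))) :=
            Ex_nonneg hp0 hp1 _ (fun _ _ => ind_nonneg _)
          refine le_trans ?_ (mul_le_mul_of_nonneg_left (h S hS.1 hS.2.1 hS.2.2) h0)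
          rw [mul_comm, ← Ex_mul]
          apply Ex_mono hp0 hp1
          intro A hA
          by_cases hc : Comp A v = S
          · rw [ind_true hc, one_mul, hc, mul_comm]
            apply mul_le_mul_of_nonneg_left _ (hψ _)
            apply ind_mono
            rintro ⟨h1, h2⟩
            rw [hc] at h1
            exact ⟨rfl, h1.nc⟩
          · rw [ind_false hc, zero_mul]
            exact mul_nonneg (hψ _) (ind_nonneg _)
        · refine le_trans (le_of_eq ?_) (Ex_nonneg hp0 hp1 _ (fun A _ => mul_nonneg (ind_nonneg _) (ind_nonneg _)))
          rw [← Ex_const p (pairs V0) 0]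
          apply Ex_congr
          intro A hA
          by_cases hc : Comp A v = S
          · have : ¬ Good A v K := by
              rintro ⟨h1, h2⟩
              rw [hc] at h2
              exact hS ⟨hc ▸ Comp_subset hv hA, hc ▸ self_mem_Comp A v, h2⟩
            rw [ind_false this]; simp
          · rw [ind_false hc, zero_mul]
    _ = Ex p (pairs V0) (fun A => ∑ S : Finset V, ind (Comp A v = S) * ind (NC A)) :=
        (Ex_sum _ _ _ _).symm
    _ = _ := Ex_congr _ _ (fun A _ => (part A _).symm)

end Rec
end CG

namespace CG
open Finset
open scoped Classical
section Paths
variable {V : Type*} [DecidableEq V]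

/-- path ending (at the last entry) in `Γ`, otherwise outside `Γ` -/
def OP (A : Finset (Sym2 V)) (Γ : Finset V) : List V → Prop
  | [] => False
  | [g] => g ∈ Γ
  | x :: y :: l => x ∉ Γ ∧ x ∉ y :: l ∧ s(x, y) ∈ A ∧ OP A Γ (y :: l)

/-- edges of a list -/
def pe : List V → Finset (Sym2 V)
  | [] => ∅
  | [_] => ∅
  | x :: y :: l => insert s(x, y) (pe (y :: l))

lemma pe_mem {L : List V} {a b : V} (h : s(a, b) ∈ pe L) : a ∈ L ∧ b ∈ L := by
  induction L with
  | nil => simp [pe] at h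
  | cons x l ih =>
    cases l with
    | nil => simp [pe] at h
    | cons y l =>
      rw [pe, Finset.mem_insert] at h
      rcases h with h | h
      · rw [Sym2.eq_iff] at h
        rcases h with ⟨rfl, rfl⟩ | ⟨rfl, rfl⟩ <;> simp
      · have := ih h
        exact ⟨List.mem_cons_of_mem _ this.1, List.mem_cons_of_mem _ this.2⟩

lemma pe_card {L : List V} (h : L.Nodup) : #(pe L) = L.length - 1 := by
  induction L with
  | nil => simp [pe]
  | cons x l ih =>
    cases l with
    | nil => simp [pe]
    | cons y l =>
      rw [pe, Finset.card_insert_of_notMem, ih h.of_cons]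
      · simp
      · intro h'
        exact (List.nodup_cons.1 h).1 (pe_mem h').1

lemma pe_notMem_head {x y z : V} {l : List V} (h : (x :: y :: l).Nodup) (hz : z ≠ y) :
    s(x, z) ∉ pe (x :: y :: l) := by
  rw [pe, Finset.mem_insert]
  rintro (h' | h')
  · exact hz (Sym2.congr_right.1 h')
  · exact (List.nodup_cons.1 h).1 (pe_mem h').1

lemma pe_subset_pairs {L : List V} (h : L.Nodup) {S : Finset V} (hS : ∀ x ∈ L, x ∈ S) :
    pe L ⊆ pairs S := by
  induction L with
  | nil => simp [pe]
  | cons x l ih =>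
    cases l with
    | nil => simp [pe]
    | cons y l =>
      rw [pe, Finset.insert_subset_iff]
      refine ⟨mem_pairs.2 ⟨hS _ (by simp), hS _ (by simp), ?_⟩, ih h.of_cons (fun z hz => hS z (List.mem_cons_of_mem _ hz))⟩
      rintro rfl
      exact (List.nodup_cons.1 h).1 (by simp)

lemma OP.nodup {A : Finset (Sym2 V)} {Γ : Finset V} {L : List V} (h : OP A Γ L) : L.Nodup := by
  induction L with
  | nil => simp
  | cons x l ih =>
    cases l with
    | nil => simp
    | cons y l => exact List.nodup_cons.2 ⟨h.2.1, ih h.2.2.2⟩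

lemma OP.pe_subset {A : Finset (Sym2 V)} {Γ : Finset V} {L : List V} (h : OP A Γ L) : pe L ⊆ A := by
  induction L with
  | nil => simp [pe]
  | cons x l ih =>
    cases l with
    | nil => simp [pe]
    | cons y l => exact Finset.insert_subset h.2.2.1 (ih h.2.2.2)

lemma OP.suffix {A : Finset (Sym2 V)} {Γ : Finset V} (L₁ : List V) {L : List V} (hL : L ≠ [])
    (h : OP A Γ (L₁ ++ L)) : OP A Γ L := by
  induction L₁ with
  | nil => exact h
  | cons x l ih =>
    apply ih
    rw [List.cons_append] at h
    cases h' : l ++ L with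
    | nil => simp at h'; exact absurd h'.2 hL
    | cons y m => rw [h'] at h; exact h.2.2.2

lemma OP.exists_of_mem {A : Finset (Sym2 V)} {Γ : Finset V} {L : List V} (h : OP A Γ L) {w : V}
    (hw : w ∈ L) : ∃ l, OP A Γ (w :: l) := by
  obtain ⟨s, t, rfl⟩ := List.append_of_mem hw
  exact ⟨t, h.suffix s (by simp)⟩

lemma OP.drop {A : Finset (Sym2 V)} {Γ : Finset V} {L : List V} (h : OP A Γ L) {k : ℕ}
    (hk : k + 1 ≤ L.length) : ∃ L', OP A Γ L' ∧ L'.length = k + 1 := by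
  refine ⟨L.drop (L.length - (k+1)), ?_, ?_⟩
  · apply OP.suffix (L.take (L.length - (k+1)))
    · intro h0
      have := congrArg List.length h0
      rw [List.length_drop] at this
      simp at this; omega
    · rwa [List.take_append_drop]
  · rw [List.length_drop]; omega

lemma OP.congr {A B : Finset (Sym2 V)} {Γ : Finset V} (hAB : ∀ x ∉ Γ, ∀ y, s(x, y) ∈ A → s(x, y) ∈ B)
    {L : List V} (h : OP A Γ L) : OP B Γ L := by
  induction L with
  | nil => exact h
  | cons x l ih =>
    cases l with
    | nil => exact h
    | cons y l => exact ⟨h.1, h.2.1, hAB _ h.1 _ h.2.2.1, ih h.2.2.2⟩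

lemma reach_OP {A : Finset (Sym2 V)} {Γ : Finset V} {v w : V} (hv : v ∈ Γ) (h : Reach A v w) :
    ∃ l, OP A Γ (w :: l) := by
  induction h with
  | refl => exact ⟨[], hv⟩
  | @tail x y _ hxy ih =>
    obtain ⟨l, hl⟩ := ih
    by_cases hy : y ∈ Γ
    · exact ⟨[], hy⟩
    by_cases hy' : y ∈ x :: l
    · exact hl.exists_of_mem hy'
    · exact ⟨x :: l, hy, hy', by rwa [Sym2.eq_swap], hl⟩

lemma deg_lemma {A : Finset (Sym2 V)} {T Y : Finset V} {x : V}
    (h : ∀ z ∈ T, s(x, z) ∈ A → z ∈ Y) :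
    #(A ∩ T.sym2) ≤ #(A ∩ (T.erase x).sym2) + #Y := by
  rw [← card_star x Y]
  refine le_trans (Finset.card_le_card ?_) (Finset.card_union_le _ _)
  intro e
  induction e with | _ a b => ?_
  simp only [Finset.mem_inter, Finset.mem_union, Finset.mk_mem_sym2_iff, Finset.mem_erase]
  rintro ⟨h1, h2, h3⟩
  by_cases ha : a = x
  · subst ha
    right
    exact mem_star.2 (h b h3 h1)
  by_cases hb : b = x
  · subst hb
    right
    rw [Sym2.eq_swap] at h1 ⊢
    exact mem_star.2 (h a h2 h1)
  · left; exact ⟨h1, ⟨ha, h2⟩, hb, h3⟩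

lemma no_loop_singleton {A : Finset (Sym2 V)} {S : Finset V} (hA : A ⊆ pairs S) (x : V) :
    A ∩ ({x} : Finset V).sym2 = ∅ := by
  ext e
  induction e with | _ a b => ?_
  simp only [Finset.mem_inter, Finset.mk_mem_sym2_iff, Finset.mem_singleton, Finset.notMem_empty, iff_false]
  rintro ⟨h1, rfl, rfl⟩
  exact (mem_pairs.1 (hA h1)).2.2 rfl

/-- longest list with a property -/
lemma longest (P : List V → Prop) (B : ℕ) (hB : ∀ L, P L → L.length ≤ B) (L₀ : List V) (h : P L₀) :
    ∃ L, P L ∧ L₀.length ≤ L.length ∧ ∀ L', P L' → L'.length ≤ L.length := by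
  have hex : ∃ k, ∃ L, P L ∧ L.length = k := ⟨_, L₀, h, rfl⟩
  have hbd : ∀ k, (∃ L, P L ∧ L.length = k) → k ≤ B := by
    rintro k ⟨L, h1, rfl⟩; exact hB L h1
  obtain ⟨L, h1, h2⟩ := Nat.findGreatest_spec (P := fun k => ∃ L, P L ∧ L.length = k) (hB L₀ h) ⟨L₀, h, rfl⟩
  refine ⟨L, h1, ?_, ?_⟩
  · rw [h2]; exact Nat.le_findGreatest (hB L₀ h) ⟨L₀, h, rfl⟩
  · intro L' h'
    rw [h2]; exact Nat.le_findGreatest (hB L' h') ⟨L', h', rfl⟩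

lemma tree_lemma {A : Finset (Sym2 V)} {Γ S : Finset V} (hA : A ⊆ pairs S) (hΓ : TreeOn A Γ)
    (B : ℕ) (hB : ∀ L, OP A Γ L → L.length ≤ B)
    (hcl : ∀ x y l z, OP A Γ (x :: y :: l) → (z ∈ Γ ∨ z ∈ l) → z ≠ y → s(x, z) ∉ A)
    (T : Finset V) (hT : T.Nonempty) (hTO : ∀ w ∈ T, ∃ l, OP A Γ (w :: l)) :
    #(A ∩ T.sym2) < #T := by
  induction hn : #T using Nat.strong_induction_on generalizing T with
  | _ n ih =>
  subst hn
  by_cases hTΓ : T ⊆ Γ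
  · exact hΓ T hTΓ hT
  obtain ⟨w, hwT, hwΓ⟩ := Finset.not_subset.1 hTΓ
  obtain ⟨l0, hl0⟩ := hTO w hwT
  have hl0' : 2 ≤ (w :: l0).length := by
    cases l0 with
    | nil => exact absurd hl0 hwΓ
    | cons y l => simp
  obtain ⟨L, ⟨hL, x, hxT, l, rfl⟩, hL2, hmax⟩ := longest (fun L => OP A Γ L ∧ ∃ x ∈ T, ∃ l, L = x :: l) B
    (fun L h => hB L h.1) (w :: l0) ⟨hl0, w, hwT, l0, rfl⟩
  cases l with
  | nil => simp at hL2 hl0'; simp [hL2] at hl0'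
  | cons y l =>
  have hnb : ∀ z ∈ T, s(x, z) ∈ A → z ∈ ({y} : Finset V) := by
    intro z hz hxz
    rw [Finset.mem_singleton]
    by_contra hzy
    by_cases h1 : z ∈ Γ ∨ z ∈ l
    · exact hcl x y l z hL h1 hzy hxz
    · push Not at h1
      have hzx : z ≠ x := fun h => (mem_pairs.1 (hA hxz)).2.2 h.symm
      have := hmax (z :: x :: y :: l) ⟨⟨h1.1, by simp [*], by rwa [Sym2.eq_swap], hL⟩, z, hz, _, rfl⟩
      simp at this
  have hd := deg_lemma hnb
  have hc := Finset.card_erase_add_one hxT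
  rw [Finset.card_singleton] at hd
  rcases (T.erase x).eq_empty_or_nonempty with he | he
  · have : T = {x} := by
      rw [← Finset.insert_erase hxT, he]; rfl
    rw [this, no_loop_singleton hA]; simp
  · have := ih #(T.erase x) (by omega) (T.erase x) he (fun w hw => hTO w (Finset.mem_of_mem_erase hw)) rfl
    omega

lemma pe_tree {L : List V} (h : L.Nodup) (T : Finset V) (hT : T.Nonempty) :
    #(pe L ∩ T.sym2) < #T := by
  induction L generalizing T with
  | nil => simpa [pe] using hT
  | cons x l ih =>
    cases l with
    | nil => simpa [pe] using hT
    | cons y l =>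
      have hx := (List.nodup_cons.1 h).1
      by_cases hxT : x ∈ T
      · have hnb : ∀ z ∈ T, s(x, z) ∈ pe (x :: y :: l) → z ∈ ({y} : Finset V) := by
          intro z _ hz
          rw [Finset.mem_singleton]
          by_contra hzy
          exact pe_notMem_head h hzy hz
        have hd := deg_lemma hnb
        rw [Finset.card_singleton] at hd
        have hc := Finset.card_erase_add_one hxT
        rcases (T.erase x).eq_empty_or_nonempty with he | he
        · have : T = {x} := by
            rw [← Finset.insert_erase hxT, he]; rfl
          rw [this, no_loop_singleton (pe_subset_pairs h (S := (x :: y :: l).toFinset) (by simp))]; simp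
        · have h1 := ih h.of_cons (T.erase x) he
          have h2 : pe (x :: y :: l) ∩ (T.erase x).sym2 ⊆ pe (y :: l) ∩ (T.erase x).sym2 := by
            intro e
            rw [Finset.mem_inter, Finset.mem_inter, pe, Finset.mem_insert]
            rintro ⟨rfl | h', h''⟩
            · simp at h''
            · exact ⟨h', h''⟩
          have := Finset.card_le_card h2
          omega
      · have h1 := ih h.of_cons T hT
        have h2 : pe (x :: y :: l) ∩ T.sym2 ⊆ pe (y :: l) ∩ T.sym2 := by
          intro e
          rw [Finset.mem_inter, Finset.mem_inter, pe, Finset.mem_insert]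
          rintro ⟨rfl | h', h''⟩
          · simp [hxT] at h''
          · exact ⟨h', h''⟩
        have := Finset.card_le_card h2
        omega

lemma OP_hp_aux {A : Finset (Sym2 V)} {Γ V0 : Finset V} (hA : A ⊆ pairs V0) (l : List V) :
    ∀ (y : V) (j : ℕ) (S : Finset V), OP A Γ (y :: l) → hp A j S y → S ⊆ V0 \ Γ →
      (∀ z ∈ y :: l, z ∉ S) → ∃ g ∈ Γ, hp A (j + l.length) (V0 \ Γ) g := by
  induction l with
  | nil =>
    intro y j S h1 h2 h3 h4
    exact ⟨y, h1, hp_mono j S _ y (h4 y (by simp)) h3 (fun e he _ => he) h2⟩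
  | cons y' l ih =>
    intro y j S h1 h2 h3 h4
    obtain ⟨g, hg, h⟩ := ih y' (j+1) (insert y S) h1.2.2.2
      ⟨y, by simp, by rw [Sym2.eq_swap]; exact h1.2.2.1, by
        rw [Finset.erase_insert (h4 y (by simp))]; exact h2⟩
      (by
        rw [Finset.insert_subset_iff, Finset.mem_sdiff]
        exact ⟨⟨(mem_pairs.1 (hA h1.2.2.1)).1, h1.1⟩, h3⟩)
      (by
        intro z hz
        rw [Finset.mem_insert]
        rintro (rfl | h)
        · exact h1.2.1 hz
        · exact h4 z (List.mem_cons_of_mem _ hz) h)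
    refine ⟨g, hg, ?_⟩
    rw [List.length_cons, show j + (l.length + 1) = j + 1 + l.length by ring]
    exact h

lemma OP_hp {A : Finset (Sym2 V)} {Γ V0 : Finset V} (hA : A ⊆ pairs V0) {L : List V} {h : ℕ}
    (hL : OP A Γ L) (hlen : L.length = h + 1) : ∃ g ∈ Γ, hp A h (V0 \ Γ) g := by
  cases L with
  | nil => simp at hlen
  | cons y l =>
    have := OP_hp_aux hA l y 0 ∅ hL trivial (by simp) (by simp)
    simp at hlen
    rwa [hlen, zero_add] at this

/-- candidate lists with `s` edges -/
noncomputable def lst (V0 Γ : Finset V) : ℕ → Finset (List V)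
  | 0 => Γ.image (fun g => [g])
  | s + 1 => (V0 ×ˢ lst V0 Γ s).image (fun q => q.1 :: q.2)

lemma lst_card (V0 Γ : Finset V) (s : ℕ) : #(lst V0 Γ s) ≤ #V0 ^ s * #Γ := by
  induction s with
  | zero => simpa [lst] using Finset.card_image_le
  | succ s ih =>
    calc #(lst V0 Γ (s+1)) ≤ #(V0 ×ˢ lst V0 Γ s) := Finset.card_image_le
      _ = #V0 * #(lst V0 Γ s) := Finset.card_product _ _
      _ ≤ #V0 * (#V0 ^ s * #Γ) := Nat.mul_le_mul_left _ ih
      _ = _ := by ring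

lemma lst_length {V0 Γ : Finset V} {s : ℕ} {L : List V} (h : L ∈ lst V0 Γ s) : L.length = s + 1 := by
  induction s generalizing L with
  | zero => simp [lst] at h; obtain ⟨a, _, rfl⟩ := h; rfl
  | succ s ih =>
    simp only [lst, Finset.mem_image, Finset.mem_product, Prod.exists] at h
    obtain ⟨a, b, ⟨_, h2⟩, rfl⟩ := h
    simp [ih h2]

lemma OP.mem_lst {A : Finset (Sym2 V)} {Γ V0 : Finset V} (hA : A ⊆ pairs V0) {L : List V}
    (hL : OP A Γ L) {s : ℕ} (hs : L.length = s + 1) : L ∈ lst V0 Γ s := by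
  induction s generalizing L with
  | zero =>
    obtain ⟨a, rfl⟩ := List.length_eq_one_iff.1 hs
    simp only [lst, Finset.mem_image]
    exact ⟨a, hL, rfl⟩
  | succ s ih =>
    match L, hL, hs with
    | [], _, h => simp at h
    | [a], _, h => simp at h
    | x :: y :: l, hL, h =>
      simp only [lst, Finset.mem_image, Finset.mem_product, Prod.exists]
      exact ⟨x, y :: l, ⟨(mem_pairs.1 (hA hL.2.2.1)).1, ih hL.2.2.2 (by simpa using h)⟩, rfl⟩

end Paths
end CG

namespace CG
open Finset
open scoped Classical
section BadEv
variable {V : Type*} [DecidableEq V]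

/-- number of short paths -/
noncomputable def cnt (A : Finset (Sym2 V)) (V0 Γ : Finset V) (h : ℕ) : ℝ :=
  ∑ s ∈ range h, ∑ L ∈ lst V0 Γ s, ind (OP A Γ L)

/-- extra edge inside -/
def B0 (A P : Finset (Sym2 V)) (Γ : Finset V) : Prop := ∃ e ∈ A, e ∈ Γ.sym2 ∧ e ∉ P
/-- long path -/
def B1 (A : Finset (Sym2 V)) (Γ : Finset V) (h : ℕ) : Prop := ∃ L, OP A Γ L ∧ L.length = h + 1
/-- closing edge for a list -/
def Cl (A : Finset (Sym2 V)) (Γ : Finset V) (L : List V) (z : V) : Prop :=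
  ∃ x y l, L = x :: y :: l ∧ OP A Γ L ∧ z ≠ y ∧ s(x, z) ∈ A
/-- short cycle -/
def B2 (A : Finset (Sym2 V)) (Γ : Finset V) (h : ℕ) : Prop :=
  ∃ L z, L.length ≤ h ∧ z ∈ Γ ∪ L.toFinset ∧ Cl A Γ L z
/-- bad event -/
def Bad (A P : Finset (Sym2 V)) (V0 Γ : Finset V) (h : ℕ) (K : ℝ) : Prop :=
  B0 A P Γ ∨ B1 A Γ h ∨ B2 A Γ h ∨ K < cnt A V0 Γ h

lemma OP_iff {A P : Finset (Sym2 V)} {Γ : Finset V} (hP : P ⊆ Γ.sym2) (L : List V) :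
    OP A Γ L ↔ OP (A \ P) Γ L := by
  constructor
  · apply OP.congr
    intro x hx y h
    rw [Finset.mem_sdiff]
    refine ⟨h, fun h' => hx ?_⟩
    exact (Finset.mk_mem_sym2_iff.1 (hP h')).1
  · apply OP.congr
    intro x hx y h
    exact (Finset.mem_sdiff.1 h).1

lemma Cl_iff {A P : Finset (Sym2 V)} {Γ : Finset V} (hP : P ⊆ Γ.sym2) (L : List V) (z : V) :
    Cl A Γ L z ↔ Cl (A \ P) Γ L z := by
  unfold Cl
  constructor
  · rintro ⟨x, y, l, rfl, h1, h2, h3⟩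
    refine ⟨x, y, l, rfl, (OP_iff hP _).1 h1, h2, ?_⟩
    rw [Finset.mem_sdiff]
    exact ⟨h3, fun h' => h1.1 (Finset.mk_mem_sym2_iff.1 (hP h')).1⟩
  · rintro ⟨x, y, l, rfl, h1, h2, h3⟩
    exact ⟨x, y, l, rfl, (OP_iff hP _).2 h1, h2, (Finset.mem_sdiff.1 h3).1⟩

lemma Bad_iff {A P : Finset (Sym2 V)} {Γ V0 : Finset V} (hP : P ⊆ Γ.sym2) (h : ℕ) (K : ℝ) :
    Bad A P V0 Γ h K ↔ Bad (A \ P) P V0 Γ h K := by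
  have h0 : B0 A P Γ ↔ B0 (A \ P) P Γ := by
    unfold B0
    simp only [Finset.mem_sdiff]
    constructor
    · rintro ⟨e, h1, h2, h3⟩; exact ⟨e, ⟨h1, h3⟩, h2, h3⟩
    · rintro ⟨e, ⟨h1, h3⟩, h2, _⟩; exact ⟨e, h1, h2, h3⟩
  have h1 : B1 A Γ h ↔ B1 (A \ P) Γ h := by
    unfold B1; simp only [OP_iff (A := A) hP]
  have h2 : B2 A Γ h ↔ B2 (A \ P) Γ h := by
    unfold B2; simp only [Cl_iff (A := A) hP]
  have h3 : cnt A V0 Γ h = cnt (A \ P) V0 Γ h := by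
    unfold cnt; simp only [OP_iff (A := A) hP]
  unfold Bad
  rw [h0, h1, h2, h3]

lemma good_of_not_bad [Fintype V] {A : Finset (Sym2 V)} {V0 : Finset V} {γ : List V} {h : ℕ} {K : ℝ} {v : V}
    (hA : A ⊆ pairs V0) (hγ : γ.Nodup) (hv : v ∈ γ)
    (hb : ¬ Bad A (pe γ) V0 γ.toFinset h K) : Good A v K := by
  unfold Bad at hb
  push Not at hb
  obtain ⟨b0, b1, b2, b3⟩ := hb
  set Γ := γ.toFinset with hΓ
  have hvΓ : v ∈ Γ := List.mem_toFinset.2 hv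
  have hlen : ∀ L, OP A Γ L → L.length ≤ h := by
    intro L hL
    by_contra hc
    exact b1 (hL.drop (by omega))
  constructor
  · intro T hT hTn
    apply tree_lemma hA _ h hlen _ T hTn
    · intro w hw
      exact reach_OP hvΓ (mem_Comp.1 (hT hw))
    · intro T' hT' hn
      refine lt_of_le_of_lt (Finset.card_le_card ?_) (pe_tree hγ T' hn)
      intro e he
      rw [Finset.mem_inter] at he ⊢
      refine ⟨?_, he.2⟩
      by_contra hc
      exact b0 ⟨e, he.1, Finset.sym2_mono hT' he.2, hc⟩
    · intro x y l z h1 h2 h3 h4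
      apply b2
      refine ⟨x :: y :: l, z, hlen _ h1, ?_, x, y, l, rfl, h1, h3, h4⟩
      rcases h2 with h2 | h2 <;> simp [h2]
  · refine le_trans ?_ b3
    have : Comp A v ⊆ ((range h).biUnion (fun s => (lst V0 Γ s).filter (OP A Γ))).image (fun L => L.headD v) := by
      intro w hw
      obtain ⟨l, hl⟩ := reach_OP hvΓ (mem_Comp.1 hw)
      rw [Finset.mem_image]
      refine ⟨w :: l, ?_, rfl⟩
      rw [Finset.mem_biUnion]
      have := hlen _ hl
      rw [List.length_cons] at this
      exact ⟨l.length, by simp; omega, Finset.mem_filter.2 ⟨hl.mem_lst hA rfl, hl⟩⟩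
    calc (#(Comp A v) : ℝ) ≤ ((∑ s ∈ range h, #((lst V0 Γ s).filter (OP A Γ)) : ℕ) : ℝ) := by
          exact_mod_cast (Finset.card_le_card this).trans (Finset.card_image_le.trans Finset.card_biUnion_le)
      _ = _ := by
          unfold cnt
          push_cast
          apply Finset.sum_congr rfl
          intro s _
          rw [Finset.card_filter]
          push_cast
          rfl

variable {p : ℝ}

lemma prob_B0 (hp0 : 0 ≤ p) (hp1 : p ≤ 1) (V0 Γ : Finset V) (P : Finset (Sym2 V)) :
    Ex p (pairs V0) (fun A => ind (B0 A P Γ)) ≤ (#Γ : ℝ) ^ 2 * p := by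
  calc Ex p (pairs V0) (fun A => ind (B0 A P Γ)) ≤
      Ex p (pairs V0) (fun A => ∑ q ∈ Γ ×ˢ Γ, ind ({s(q.1, q.2)} ⊆ A)) := by
        apply Ex_mono hp0 hp1
        intro A _
        apply ind_le_sum
        rintro ⟨e, he, h1, _⟩
        induction e with | _ a b => ?_
        rw [Finset.mk_mem_sym2_iff] at h1
        exact ⟨(a, b), Finset.mem_product.2 h1, by simpa using he⟩
    _ = ∑ q ∈ Γ ×ˢ Γ, Ex p (pairs V0) (fun A => ind ({s(q.1, q.2)} ⊆ A)) := Ex_sum _ _ _ _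
    _ ≤ ∑ q ∈ Γ ×ˢ Γ, p := by
        apply Finset.sum_le_sum
        intro q _
        simpa using Ex_subset_le hp0 {s(q.1, q.2)} (pairs V0)
    _ = _ := by rw [Finset.sum_const, Finset.card_product, nsmul_eq_mul]; push_cast; ring

lemma prob_B1 (hp0 : 0 ≤ p) (hp1 : p ≤ 1) (V0 Γ : Finset V) (hΓ : Γ ⊆ V0) (n h : ℕ) (hn : #V0 ≤ n) :
    Ex p (pairs V0) (fun A => ind (B1 A Γ h)) ≤ (#Γ : ℝ) * Q p n h := by
  calc Ex p (pairs V0) (fun A => ind (B1 A Γ h)) ≤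
      Ex p (pairs V0) (fun A => ∑ g ∈ Γ, ind (hp A h (V0 \ Γ) g)) := by
        apply Ex_mono hp0 hp1
        intro A hA
        apply ind_le_sum
        rintro ⟨L, hL, hlen⟩
        exact OP_hp hA hL hlen
    _ = ∑ g ∈ Γ, Ex p (pairs V0) (fun A => ind (hp A h (V0 \ Γ) g)) := Ex_sum _ _ _ _
    _ ≤ ∑ g ∈ Γ, Q p n h := by
        apply Finset.sum_le_sum
        intro g hg
        have hg' : g ∉ V0 \ Γ := by simp [hg]
        have hsub : insert g (V0 \ Γ) ⊆ V0 := Finset.insert_subset (hΓ hg) Finset.sdiff_subset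
        rw [Ex_marginal p (E' := pairs (insert g (V0 \ Γ))) (pairs_mono hsub)]
        · exact hp_prob hp0 hp1 n h _ g hg' ((Finset.card_le_card Finset.sdiff_subset).trans hn)
        · intro A hA
          congr 1
          apply propext
          constructor
          · apply hp_mono h _ _ g hg' subset_rfl
            intro e he he'
            rw [Finset.mem_inter]
            refine ⟨he, ?_⟩
            rw [pairs, Finset.mem_filter]
            refine ⟨he', ?_⟩
            have := hA he
            rw [pairs, Finset.mem_filter] at this
            exact this.2
          · apply hp_mono h _ _ g hg' subset_rfl
            intro e he _
            exact (Finset.mem_inter.1 he).1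
    _ = _ := by simp

lemma Ex_ind_le_of (hp0 : 0 ≤ p) (hp1 : p ≤ 1) {α : Type*} [DecidableEq α] (E : Finset α) (P : Finset α → Prop) (B : Finset α) (k : ℕ)
    (h1 : ∀ A ⊆ E, P A → B ⊆ A ∧ #B = k) : Ex p E (fun A => ind (P A)) ≤ p ^ k := by
  by_cases h : ∃ A ⊆ E, P A
  · obtain ⟨A0, hA0, hP⟩ := h
    rw [← (h1 A0 hA0 hP).2]
    exact (Ex_mono hp0 hp1 E (fun A hA => ind_mono (fun hP => (h1 A hA hP).1))).trans (Ex_subset_le hp0 B E)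
  · push Not at h
    calc Ex p E (fun A => ind (P A)) = Ex p E (fun _ => 0) := Ex_congr _ _ (fun A hA => ind_false (h A hA))
      _ = 0 := Ex_const _ _ _
      _ ≤ _ := by positivity

lemma prob_B2 (hp0 : 0 ≤ p) (hp1 : p ≤ 1) (V0 Γ : Finset V) (n h : ℕ) (hn : #V0 ≤ n) :
    Ex p (pairs V0) (fun A => ind (B2 A Γ h)) ≤
      ∑ s ∈ range h, (n : ℝ) ^ s * #Γ * ((#Γ : ℝ) + s + 1) * p ^ (s + 1) := by
  calc Ex p (pairs V0) (fun A => ind (B2 A Γ h)) ≤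
      Ex p (pairs V0) (fun A => ∑ s ∈ range h, ∑ L ∈ lst V0 Γ s, ∑ z ∈ Γ ∪ L.toFinset, ind (Cl A Γ L z)) := by
        apply Ex_mono hp0 hp1
        intro A hA
        by_cases hB : B2 A Γ h
        · rw [ind_true hB]
          obtain ⟨L, z, h1, h2, h3⟩ := hB
          have hOP : OP A Γ L := by obtain ⟨x, y, l, _, h, _⟩ := h3; exact h
          obtain ⟨s, hs⟩ : ∃ s, L.length = s + 1 := by
            obtain ⟨x, y, l, rfl, h, _⟩ := h3
            exact ⟨_, rfl⟩
          have hL := hOP.mem_lst hA hs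
          rw [← ind_true h3]
          have e1 := Finset.single_le_sum (f := fun z => ind (Cl A Γ L z)) (fun _ _ => ind_nonneg _) h2
          have e2 := Finset.single_le_sum (f := fun L => ∑ z ∈ Γ ∪ L.toFinset, ind (Cl A Γ L z))
            (fun _ _ => Finset.sum_nonneg (fun _ _ => ind_nonneg _)) hL
          have e3 := Finset.single_le_sum (f := fun s => ∑ L ∈ lst V0 Γ s, ∑ z ∈ Γ ∪ L.toFinset, ind (Cl A Γ L z))
            (fun _ _ => Finset.sum_nonneg (fun _ _ => Finset.sum_nonneg (fun _ _ => ind_nonneg _)))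
            (Finset.mem_range.2 (by omega : s < h))
          exact e1.trans (e2.trans e3)
        · rw [ind_false hB]
          exact Finset.sum_nonneg (fun _ _ => Finset.sum_nonneg (fun _ _ => Finset.sum_nonneg (fun _ _ => ind_nonneg _)))
    _ = ∑ s ∈ range h, ∑ L ∈ lst V0 Γ s, ∑ z ∈ Γ ∪ L.toFinset, Ex p (pairs V0) (fun A => ind (Cl A Γ L z)) := by
        simp only [Ex_sum]
    _ ≤ _ := by
        apply Finset.sum_le_sum
        intro s _
        calc ∑ L ∈ lst V0 Γ s, ∑ z ∈ Γ ∪ L.toFinset, Ex p (pairs V0) (fun A => ind (Cl A Γ L z))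
            ≤ ∑ L ∈ lst V0 Γ s, ((#Γ : ℝ) + s + 1) * p ^ (s + 1) := by
              apply Finset.sum_le_sum
              intro L hL
              calc ∑ z ∈ Γ ∪ L.toFinset, Ex p (pairs V0) (fun A => ind (Cl A Γ L z))
                  ≤ ∑ z ∈ Γ ∪ L.toFinset, p ^ (s + 1) := by
                    apply Finset.sum_le_sum
                    intro z _
                    apply Ex_ind_le_of hp0 hp1 _ _ (insert s(L.headD z, z) (pe L))
                    rintro A hA ⟨x, y, l, rfl, h1, h2, h3⟩
                    refine ⟨Finset.insert_subset h3 h1.pe_subset, ?_⟩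
                    rw [List.headD_cons, Finset.card_insert_of_notMem (pe_notMem_head h1.nodup h2), pe_card h1.nodup,
                      lst_length hL]
                    rfl
                _ = #(Γ ∪ L.toFinset) * p ^ (s + 1) := by simp
                _ ≤ _ := by
                    apply mul_le_mul_of_nonneg_right _ (by positivity)
                    have h1 := Finset.card_union_le Γ L.toFinset
                    have h2 := L.toFinset_card_le
                    rw [lst_length hL] at h2
                    have : #(Γ ∪ L.toFinset) ≤ #Γ + (s + 1) := by omega
                    have h3 : (#(Γ ∪ L.toFinset) : ℝ) ≤ (#Γ : ℝ) + (s + 1) := by exact_mod_cast this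
                    linarith
          _ = #(lst V0 Γ s) * (((#Γ : ℝ) + s + 1) * p ^ (s + 1)) := by simp
          _ ≤ ((n : ℝ) ^ s * #Γ) * (((#Γ : ℝ) + s + 1) * p ^ (s + 1)) := by
              apply mul_le_mul_of_nonneg_right _ (by positivity)
              have h1 := (lst_card V0 Γ s).trans (Nat.mul_le_mul_right _ (Nat.pow_le_pow_left hn s))
              exact_mod_cast h1
          _ = _ := by ring

lemma prob_B3 (hp0 : 0 ≤ p) (hp1 : p ≤ 1) (V0 Γ : Finset V) (n h : ℕ) (hn : #V0 ≤ n) {K : ℝ} (hK : 0 < K) :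
    Ex p (pairs V0) (fun A => ind (K < cnt A V0 Γ h)) ≤
      (∑ s ∈ range h, #Γ * ((n : ℝ) * p) ^ s) / K := by
  have hc0 : ∀ A, 0 ≤ cnt A V0 Γ h := fun A =>
    Finset.sum_nonneg (fun _ _ => Finset.sum_nonneg (fun _ _ => ind_nonneg _))
  calc Ex p (pairs V0) (fun A => ind (K < cnt A V0 Γ h)) ≤
      Ex p (pairs V0) (fun A => K⁻¹ * cnt A V0 Γ h) := by
        apply Ex_mono hp0 hp1
        intro A hA
        by_cases hc : K < cnt A V0 Γ h
        · rw [ind_true hc, ← inv_mul_cancel₀ hK.ne']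
          exact mul_le_mul_of_nonneg_left hc.le (by positivity)
        · rw [ind_false hc]
          exact mul_nonneg (by positivity) (hc0 A)
    _ = K⁻¹ * ∑ s ∈ range h, ∑ L ∈ lst V0 Γ s, Ex p (pairs V0) (fun A => ind (OP A Γ L)) := by
        rw [Ex_mul]; unfold cnt; simp only [Ex_sum]
    _ ≤ K⁻¹ * ∑ s ∈ range h, #Γ * ((n : ℝ) * p) ^ s := by
        apply mul_le_mul_of_nonneg_left _ (by positivity)
        apply Finset.sum_le_sum
        intro s _
        calc ∑ L ∈ lst V0 Γ s, Ex p (pairs V0) (fun A => ind (OP A Γ L))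
            ≤ ∑ L ∈ lst V0 Γ s, p ^ s := by
              apply Finset.sum_le_sum
              intro L hL
              apply Ex_ind_le_of hp0 hp1 _ _ (pe L)
              intro A hA h1
              refine ⟨h1.pe_subset, ?_⟩
              rw [pe_card h1.nodup, lst_length hL]; rfl
          _ = #(lst V0 Γ s) * p ^ s := by simp
          _ ≤ ((n : ℝ) ^ s * #Γ) * p ^ s := by
              apply mul_le_mul_of_nonneg_right _ (by positivity)
              have h1 := (lst_card V0 Γ s).trans (Nat.mul_le_mul_right _ (Nat.pow_le_pow_left hn s))
              exact_mod_cast h1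
          _ = _ := by rw [mul_pow]; ring
    _ = _ := by rw [div_eq_inv_mul]

lemma prob_Bad (hp0 : 0 ≤ p) (hp1 : p ≤ 1) (V0 Γ : Finset V) (P : Finset (Sym2 V)) (hΓ : Γ ⊆ V0) (n h : ℕ) (hn : #V0 ≤ n)
    {K : ℝ} (hK : 0 < K) :
    Ex p (pairs V0) (fun A => ind (Bad A P V0 Γ h K)) ≤
      (#Γ : ℝ) ^ 2 * p + (#Γ : ℝ) * Q p n h +
      ∑ s ∈ range h, (n : ℝ) ^ s * #Γ * ((#Γ : ℝ) + s + 1) * p ^ (s + 1) +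
      (∑ s ∈ range h, #Γ * ((n : ℝ) * p) ^ s) / K := by
  have h1 := prob_B0 hp0 hp1 V0 Γ P
  have h2 := prob_B1 hp0 hp1 V0 Γ hΓ n h hn
  have h3 := prob_B2 hp0 hp1 V0 Γ n h hn
  have h4 := prob_B3 hp0 hp1 V0 Γ n h hn hK
  have h5 : Ex p (pairs V0) (fun A => ind (Bad A P V0 Γ h K)) ≤
      Ex p (pairs V0) (fun A => ind (B0 A P Γ) + (ind (B1 A Γ h) + (ind (B2 A Γ h) + ind (K < cnt A V0 Γ h)))) := by
    apply Ex_mono hp0 hp1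
    intro A _
    have e1 := ind_or (B0 A P Γ) (B1 A Γ h ∨ B2 A Γ h ∨ K < cnt A V0 Γ h)
    have e2 := ind_or (B1 A Γ h) (B2 A Γ h ∨ K < cnt A V0 Γ h)
    have e3 := ind_or (B2 A Γ h) (K < cnt A V0 Γ h)
    unfold Bad
    linarith
  rw [Ex_add, Ex_add, Ex_add] at h5
  linarith

end BadEv
end CG

namespace CG
open Finset
open scoped Classical
section Low
variable {V : Type*} [DecidableEq V]

lemma conn_add {A : Finset (Sym2 V)} {X : Finset V} {x y : V} (hx : x ∉ X) (hy : y ∈ X)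
    (h : s(x, y) ∈ A) : #(A ∩ X.sym2) + 1 ≤ #(A ∩ (insert x X).sym2) := by
  have h1 : s(x, y) ∉ A ∩ X.sym2 := by simp [hx]
  rw [← Finset.card_insert_of_notMem h1]
  apply Finset.card_le_card
  apply Finset.insert_subset
  · simp [h, hy]
  · exact Finset.inter_subset_inter_left (Finset.sym2_mono (Finset.subset_insert _ _))

lemma conn_list {A : Finset (Sym2 V)} {v : V} {X : Finset V} (hv : v ∈ X) (hX : #X ≤ #(A ∩ X.sym2) + 1)
    {L : List V} (hL : OP A {v} L) : #(X ∪ L.toFinset) ≤ #(A ∩ (X ∪ L.toFinset).sym2) + 1 := by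
  induction L with
  | nil => exact absurd hL (by simp [OP])
  | cons x l ih =>
    cases l with
    | nil =>
      simp only [OP, Finset.mem_singleton] at hL
      have : X ∪ [x].toFinset = X := by
        rw [hL]; simp [hv]
      rw [this]; exact hX
    | cons y l =>
      have ih := ih hL.2.2.2
      set Y := X ∪ (y :: l).toFinset with hY
      have h1 : X ∪ (x :: y :: l).toFinset = insert x Y := by
        rw [List.toFinset_cons (a := x), Finset.union_insert]
      rw [h1]
      by_cases hx : x ∈ Y
      · rw [Finset.insert_eq_of_mem hx]; exact ih
      · have := conn_add hx (by simp [hY] : y ∈ Y) hL.2.2.1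
        rw [Finset.card_insert_of_notMem hx]
        omega

lemma OP_unique {A : Finset (Sym2 V)} {v : V} {C : Finset V} (hT : TreeOn A C)
    (hC : ∀ L, OP A {v} L → ∀ x ∈ L, x ∈ C) :
    ∀ (l1 l2 : List V) (w : V), OP A {v} (w :: l1) → OP A {v} (w :: l2) → l1 = l2 := by
  intro l1
  induction l1 with
  | nil =>
    intro l2 w h1 h2
    cases l2 with
    | nil => rfl
    | cons y l => exact absurd h1 h2.1
  | cons y1 m1 ih =>
    intro l2 w h1 h2
    cases l2 with
    | nil => exact absurd h2 h1.1
    | cons y2 m2 =>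
      by_cases hy : y1 = y2
      · subst hy
        rw [ih m2 y1 h1.2.2.2 h2.2.2.2]
      · exfalso
        have c1 := conn_list (A := A) (v := v) (X := {v}) (by simp) (by simp) h1.2.2.2
        have c2 := conn_list (A := A) (v := v) (X := {v} ∪ (y1 :: m1).toFinset) (by simp) c1 h2.2.2.2
        set X := {v} ∪ (y1 :: m1).toFinset ∪ (y2 :: m2).toFinset with hX
        have hwv : w ≠ v := fun h => h1.1 (by simp [h])
        have hw : w ∉ X := by
          have a1 := h1.2.1
          have a2 := h2.2.1
          simp only [hX, Finset.mem_union, Finset.mem_singleton, List.mem_toFinset]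
          tauto
        have hXC : insert w X ⊆ C := by
          intro x hx
          simp only [hX, Finset.mem_insert, Finset.mem_union, Finset.mem_singleton, List.mem_toFinset] at hx
          rcases hx with rfl | (rfl | h) | h
          · exact hC _ h1 _ (by simp)
          · exact hC [x] (by simp [OP]) _ (by simp)
          · exact hC _ h1 _ (List.mem_cons_of_mem _ h)
          · exact hC _ h2 _ (List.mem_cons_of_mem _ h)
        have ht := hT _ hXC (by simp)
        rw [Finset.card_insert_of_notMem hw] at ht
        have hsub : insert s(w, y1) (insert s(w, y2) (A ∩ X.sym2)) ⊆ A ∩ (insert w X).sym2 := by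
          apply Finset.insert_subset
          · simp [hX, h1.2.2.1]
          apply Finset.insert_subset
          · simp [hX, h2.2.2.1]
          · exact Finset.inter_subset_inter_left (Finset.sym2_mono (Finset.subset_insert _ _))
        have hcard := Finset.card_le_card hsub
        rw [Finset.card_insert_of_notMem, Finset.card_insert_of_notMem] at hcard
        · omega
        · simp [hw]
        · simp only [Finset.mem_insert, Finset.mem_inter, Finset.mk_mem_sym2_iff, not_or]
          exact ⟨fun h => hy (Sym2.congr_right.1 h), fun h => hw h.2.1⟩

lemma OP_in_Comp [Fintype V] {A : Finset (Sym2 V)} {v : V} : ∀ L, OP A {v} L → ∀ x ∈ L, x ∈ Comp A v := by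
  intro L
  induction L with
  | nil => simp
  | cons x l ih =>
    intro h
    cases l with
    | nil =>
      simp only [OP, Finset.mem_singleton] at h
      intro y hy
      simp at hy
      rw [hy, h]; exact self_mem_Comp A v
    | cons y l =>
      have ih := ih h.2.2.2
      intro z hz
      rcases List.mem_cons.1 hz with rfl | hz
      · exact (Comp_edge h.2.2.1).2 (ih y (by simp))
      · exact ih z hz

/-- simple paths ending in `v` with `r` edges -/
noncomputable def NP (V0 : Finset V) (v : V) : ℕ → Finset (List V)
  | 0 => {[v]}
  | r + 1 => (NP V0 v r).biUnion (fun l => (V0 \ l.toFinset).image (fun x => x :: l))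

lemma NP_spec {V0 : Finset V} {v : V} (hv : v ∈ V0) (r : ℕ) : ∀ l ∈ NP V0 v r, l.Nodup ∧ l.length = r + 1 ∧
    v ∈ l ∧ (∀ x ∈ l, x ∈ V0) ∧ ∀ A, pe l ⊆ A → OP A {v} l := by
  induction r with
  | zero => simp [NP, hv, OP]
  | succ r ih =>
    intro l' hl'
    simp only [NP, Finset.mem_biUnion, Finset.mem_image, Finset.mem_sdiff, List.mem_toFinset] at hl'
    obtain ⟨l, hl, x, ⟨hx, hxl⟩, rfl⟩ := hl'
    obtain ⟨h1, h2, h3, h4, h5⟩ := ih l hl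
    refine ⟨List.nodup_cons.2 ⟨hxl, h1⟩, by simp [h2], List.mem_cons_of_mem _ h3, ?_, ?_⟩
    · intro y hy
      rcases List.mem_cons.1 hy with rfl | hy
      · exact hx
      · exact h4 y hy
    · intro A hA
      cases l with
      | nil => simp at h3
      | cons y l =>
        rw [pe, Finset.insert_subset_iff] at hA
        refine ⟨?_, hxl, hA.1, h5 A hA.2⟩
        rw [Finset.mem_singleton]
        rintro rfl
        exact hxl h3

lemma NP_card {V0 : Finset V} {v : V} (hv : v ∈ V0) (R r : ℕ) (hr : r ≤ R) :
    (#V0 - R) ^ r ≤ #(NP V0 v r) := by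
  induction r with
  | zero => simp [NP]
  | succ r ih =>
    have ih := ih (by omega)
    rw [NP, Finset.card_biUnion]
    · calc (#V0 - R) ^ (r+1) = (#V0 - R) ^ r * (#V0 - R) := pow_succ _ _
        _ ≤ #(NP V0 v r) * (#V0 - R) := Nat.mul_le_mul_right _ ih
        _ = ∑ l ∈ NP V0 v r, (#V0 - R) := by simp
        _ ≤ _ := by
          apply Finset.sum_le_sum
          intro l hl
          rw [Finset.card_image_of_injective _ (fun a b h => (List.cons.inj h).1)]
          have h1 := (NP_spec hv r l hl).2.1
          have h2 := l.toFinset_card_le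
          have h3 := Finset.le_card_sdiff l.toFinset V0
          omega
    · intro l1 _ l2 _ hne
      rw [Function.onFun, Finset.disjoint_left]
      intro x h1 h2
      rw [Finset.mem_image] at h1 h2
      obtain ⟨a, _, rfl⟩ := h1
      obtain ⟨b, _, h⟩ := h2
      exact hne (List.cons.inj h).2.symm

lemma paths_le_comp [Fintype V] {A : Finset (Sym2 V)} {V0 : Finset V} {v : V} (hv : v ∈ V0) (R : ℕ)
    (hT : TreeOn A (Comp A v)) :
    ∑ r ∈ range R, ∑ l ∈ NP V0 v r, ind (pe l ⊆ A) ≤ (#(Comp A v) : ℝ) := by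
  have h1 : ∑ r ∈ range R, ∑ l ∈ NP V0 v r, ind (pe l ⊆ A) =
      (#((range R).biUnion (fun r => (NP V0 v r).filter (fun l => pe l ⊆ A))) : ℝ) := by
    rw [Finset.card_biUnion]
    · push_cast
      apply Finset.sum_congr rfl
      intro r _
      rw [Finset.card_filter]; push_cast; unfold ind; congr! 2
    · intro r1 _ r2 _ hne
      rw [Function.onFun, Finset.disjoint_left]
      intro l h1 h2
      have e1 := (NP_spec hv r1 l (Finset.mem_filter.1 h1).1).2.1
      have e2 := (NP_spec hv r2 l (Finset.mem_filter.1 h2).1).2.1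
      omega
  rw [h1]
  have key : ∀ l ∈ (range R).biUnion (fun r => (NP V0 v r).filter (fun l => pe l ⊆ A)), OP A {v} l := by
    intro l hl
    rw [Finset.mem_biUnion] at hl
    obtain ⟨r, _, hr⟩ := hl
    rw [Finset.mem_filter] at hr
    exact (NP_spec hv r l hr.1).2.2.2.2 A hr.2
  norm_cast
  apply Finset.card_le_card_of_injOn (fun l => l.headD v)
  · intro l hl
    have h := key l hl
    cases l with
    | nil => exact absurd h (by simp [OP])
    | cons x l => exact OP_in_Comp _ h x (by simp)
  · intro l1 hl1 l2 hl2 heq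
    have h1 := key l1 hl1
    have h2 := key l2 hl2
    cases l1 with
    | nil => exact absurd h1 (by simp [OP])
    | cons x l1 =>
    cases l2 with
    | nil => exact absurd h2 (by simp [OP])
    | cons y l2 =>
      simp only [List.headD_cons] at heq
      subst heq
      rw [OP_unique hT OP_in_Comp l1 l2 x h1 h2]

lemma comp_lower [Fintype V] {p : ℝ} (hp0 : 0 ≤ p) (hp1 : p ≤ 1) {V0 : Finset V} {v : V} (hv : v ∈ V0)
    (R h : ℕ) (K : ℝ)
    (hβ : ∀ l : List V, l.Nodup → (∀ x ∈ l, x ∈ V0) → 1 ≤ l.length → l.length ≤ R →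
      Ex p (pairs V0) (fun A => ind (Bad A (pe l) V0 l.toFinset h K)) ≤ 1/2) :
    ∑ r ∈ range R, (((#V0 - R : ℕ) : ℝ) * p) ^ r / 2 ≤
      Ex p (pairs V0) (fun A => ind (Good A v K) * #(Comp A v)) := by
  calc ∑ r ∈ range R, (((#V0 - R : ℕ) : ℝ) * p) ^ r / 2
      ≤ ∑ r ∈ range R, ∑ l ∈ NP V0 v r, p ^ r / 2 := by
        apply Finset.sum_le_sum
        intro r hr
        rw [Finset.sum_const, nsmul_eq_mul, mul_pow, mul_div_assoc]
        apply mul_le_mul_of_nonneg_right _ (by positivity)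
        exact_mod_cast NP_card hv R r (Finset.mem_range.1 hr).le
    _ ≤ ∑ r ∈ range R, ∑ l ∈ NP V0 v r, Ex p (pairs V0) (fun A => ind (Good A v K) * ind (pe l ⊆ A)) := by
        apply Finset.sum_le_sum
        intro r hr
        apply Finset.sum_le_sum
        intro l hl
        obtain ⟨h1, h2, h3, h4, -⟩ := NP_spec hv r l hl
        have hb := hβ l h1 h4 (by omega) (by have := Finset.mem_range.1 hr; omega)
        have hPs : pe l ⊆ l.toFinset.sym2 := by
          intro e
          induction e with | _ a b => ?_
          intro h
          simp [pe_mem h]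
        calc p ^ r / 2 ≤ p ^ r * (1 - Ex p (pairs V0) (fun A => ind (Bad A (pe l) V0 l.toFinset h K))) := by
              have : 0 ≤ p ^ r := by positivity
              nlinarith
          _ = p ^ #(pe l) * Ex p (pairs V0) (fun A => 1 - ind (Bad A (pe l) V0 l.toFinset h K)) := by
              rw [Ex_sub, Ex_const, pe_card h1, h2]; rfl
          _ = Ex p (pairs V0) (fun A => ind (pe l ⊆ A) * (1 - ind (Bad A (pe l) V0 l.toFinset h K))) := by
              rw [Ex_subset_mul p (pe_subset_pairs h1 h4)]
              intro A _
              rw [Bad_iff hPs]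
          _ ≤ _ := by
              apply Ex_mono hp0 hp1
              intro A hA
              rw [mul_comm]
              apply mul_le_mul_of_nonneg_right _ (ind_nonneg _)
              rw [← ind_not]
              exact ind_mono (good_of_not_bad hA h1 h3)
    _ = Ex p (pairs V0) (fun A => ind (Good A v K) * ∑ r ∈ range R, ∑ l ∈ NP V0 v r, ind (pe l ⊆ A)) := by
        simp only [← Ex_sum, Finset.mul_sum]
    _ ≤ _ := by
        apply Ex_mono hp0 hp1
        intro A hA
        by_cases hg : Good A v K
        · exact mul_le_mul_of_nonneg_left (paths_le_comp hv R hg.1) (ind_nonneg _)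
        · rw [ind_false hg]; simp

lemma good_prob [Fintype V] {p : ℝ} (hp0 : 0 ≤ p) (hp1 : p ≤ 1) {V0 : Finset V} {v : V}
    (h : ℕ) (K : ℝ) :
    1 - Ex p (pairs V0) (fun A => ind (Bad A (pe [v]) V0 [v].toFinset h K)) ≤
      Ex p (pairs V0) (fun A => ind (Good A v K)) := by
  rw [← Ex_const p (pairs V0) 1, ← Ex_sub]
  apply Ex_mono hp0 hp1
  intro A hA
  rw [← ind_not]
  exact ind_mono (good_of_not_bad hA (by simp) (by simp))

end Low
end CG

namespace CG
open Finset
open scoped Classical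
section Base
variable {V : Type*} [DecidableEq V]

lemma pe_concat (l : List V) (a b : V) : pe (l ++ [a, b]) = insert s(a, b) (pe (l ++ [a])) := by
  induction l with
  | nil => simp [pe]
  | cons x l ih =>
    cases l with
    | nil => simp only [List.cons_append, List.nil_append, pe]; rw [Finset.insert_comm]
    | cons y l =>
      simp only [List.cons_append, pe] at ih ⊢
      rw [ih, Finset.insert_comm]

lemma pe_reverse (l : List V) : pe l.reverse = pe l := by
  induction l with
  | nil => rfl
  | cons x l ih =>
    cases l with
    | nil => rfl
    | cons y l =>
      rw [List.reverse_cons] at ih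
      rw [List.reverse_cons, List.reverse_cons, List.append_assoc, List.singleton_append, pe_concat, ih, pe, Sym2.eq_swap]

/-- bicyclic witness -/
def Cx (A : Finset (Sym2 V)) (L : List V) (z z' : V) : Prop :=
  ∃ u w m x y k, L.Nodup ∧ L = u :: w :: m ∧ L.reverse = x :: y :: k ∧ z ≠ w ∧ z' ≠ y ∧
    s(u, z) ≠ s(x, z') ∧ pe L ⊆ A ∧ s(u, z) ∈ A ∧ s(x, z') ∈ A

noncomputable def nb (A : Finset (Sym2 V)) (T : Finset V) (x : V) : Finset V := T.filter (fun z => s(x, z) ∈ A)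

lemma handshake {A : Finset (Sym2 V)} {V0 T : Finset V} (hA : A ⊆ pairs V0) :
    2 * #(A ∩ T.sym2) ≤ ∑ x ∈ T, #(nb A T x) := by
  have h := Finset.sum_card_bipartiteAbove_eq_sum_card_bipartiteBelow (s := T) (t := A ∩ T.sym2)
    (fun x e => x ∈ e)
  calc 2 * #(A ∩ T.sym2) = ∑ e ∈ A ∩ T.sym2, 2 := by simp [mul_comm]
    _ ≤ ∑ e ∈ A ∩ T.sym2, #(Finset.bipartiteBelow (fun x e => x ∈ e) T e) := by
        apply Finset.sum_le_sum
        intro e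
        induction e with | _ a b => ?_
        intro he
        rw [Finset.mem_inter, Finset.mk_mem_sym2_iff] at he
        have hab := (mem_pairs.1 (hA he.1)).2.2
        rw [← Finset.card_pair hab]
        apply Finset.card_le_card
        intro x hx
        simp only [Finset.mem_insert, Finset.mem_singleton] at hx
        rw [Finset.mem_bipartiteBelow]
        rcases hx with rfl | rfl
        · exact ⟨he.2.1, by simp⟩
        · exact ⟨he.2.2, by simp⟩
    _ = ∑ x ∈ T, #(Finset.bipartiteAbove (fun x e => x ∈ e) (A ∩ T.sym2) x) := h.symm
    _ ≤ _ := by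
        apply Finset.sum_le_sum
        intro x hx
        rw [← card_star x]
        apply Finset.card_le_card
        intro e he
        rw [Finset.mem_bipartiteAbove] at he
        obtain ⟨h1, h2⟩ := he
        obtain ⟨y, rfl⟩ := Sym2.mem_iff_exists.1 h2
        rw [mem_star, nb, Finset.mem_filter]
        rw [Finset.mem_inter, Finset.mk_mem_sym2_iff] at h1
        exact ⟨h1.2.2, h1.1⟩

lemma not_NC {A : Finset (Sym2 V)} {V0 : Finset V} (hA : A ⊆ pairs V0) (h : ¬ NC A) :
    ∃ L z z', L.Nodup ∧ (∀ x ∈ L, x ∈ V0) ∧ z ∈ L ∧ z' ∈ L ∧ Cx A L z z' := by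
  unfold NC at h
  push Not at h
  obtain ⟨T0, hT0⟩ := h
  obtain ⟨T, hT, hmin⟩ : ∃ T : Finset V, #T < #(A ∩ T.sym2) ∧ ∀ T' : Finset V, #T' < #T → #(A ∩ T'.sym2) ≤ #T' := by
    have hex : ∃ k, ∃ T : Finset V, #T = k ∧ #T < #(A ∩ T.sym2) := ⟨_, T0, rfl, hT0⟩
    obtain ⟨T, h1, h2⟩ := Nat.find_spec hex
    refine ⟨T, h2, fun T' h' => ?_⟩
    by_contra hc
    exact Nat.find_min hex (h1 ▸ h') ⟨T', rfl, by omega⟩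
  have hloop : ∀ x, s(x, x) ∉ A := fun x hx => (mem_pairs.1 (hA hx)).2.2 rfl
  have hdeg : ∀ x ∈ T, 2 ≤ #(nb A T x) := by
    intro x hx
    have h1 := deg_lemma (A := A) (T := T) (Y := nb A T x) (x := x)
      (fun z hz hxz => Finset.mem_filter.2 ⟨hz, hxz⟩)
    have h2 := Finset.card_erase_add_one hx
    have h3 := hmin (T.erase x) (by omega)
    omega
  obtain ⟨z0, hz0, hz0d⟩ : ∃ z ∈ T, 3 ≤ #(nb A T z) := by
    by_contra hc
    push Not at hc
    have h1 := handshake (T := T) hA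
    have h2 : ∑ x ∈ T, #(nb A T x) ≤ ∑ x ∈ T, 2 := Finset.sum_le_sum (fun x hx => by have := hc x hx; omega)
    simp at h2
    omega
  have hTV : T ⊆ V0 := by
    intro x hx
    have := hdeg x hx
    obtain ⟨z, hz⟩ := Finset.card_pos.1 (by omega : 0 < #(nb A T x))
    exact (mem_pairs.1 (hA (Finset.mem_filter.1 hz).2)).1
  have hPlen : ∀ L : List V, L.Nodup → (∀ x ∈ L, x ∈ T) → L.length ≤ #T := by
    intro L h1 h2
    rw [← List.toFinset_card_of_nodup h1]
    exact Finset.card_le_card (fun x hx => h2 x (List.mem_toFinset.1 hx))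
  -- first longest path
  obtain ⟨z1, hz1⟩ := Finset.card_pos.1 (by omega : 0 < #(nb A T z0))
  rw [nb, Finset.mem_filter] at hz1
  have hz10 : z1 ≠ z0 := by rintro rfl; exact hloop _ hz1.2
  obtain ⟨l, ⟨hl1, hl2, hl3, l0, hl4⟩, hl5, hlmax⟩ := longest
    (fun L => L.Nodup ∧ (∀ x ∈ L, x ∈ T) ∧ pe L ⊆ A ∧ ∃ l0, L = l0 ++ [z0]) #T
    (fun L h => hPlen L h.1 h.2.1) [z1, z0]
    ⟨by simp [hz10], by simp [hz0, hz1.1], by simp [pe, Sym2.eq_swap, hz1.2], [z1], rfl⟩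
  match l, hl5 with
  | [], h => simp at h
  | [_], h => simp at h
  | x :: y :: l', _ =>
  have hx := hdeg x (hl2 x (by simp))
  obtain ⟨z', hz', hz'y⟩ := Finset.exists_mem_ne (by omega : 1 < #(nb A T x)) y
  rw [nb, Finset.mem_filter] at hz'
  have hz'l : z' ∈ x :: y :: l' := by
    by_contra hc
    have := hlmax (z' :: x :: y :: l') ⟨List.nodup_cons.2 ⟨hc, hl1⟩, by
      intro a ha
      rcases List.mem_cons.1 ha with rfl | ha
      · exact hz'.1
      · exact hl2 a ha, by
      rw [pe]; exact Finset.insert_subset (by rw [Sym2.eq_swap]; exact hz'.2) hl3,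
      z' :: l0, by rw [hl4]; rfl⟩
    simp at this
  have hxz0 : x ≠ z0 := by
    rintro rfl
    cases l0 with
    | nil => simp at hl4
    | cons a l0 =>
      simp only [List.cons_append, List.cons.injEq] at hl4
      have := (List.nodup_cons.1 hl1).1
      rw [hl4.2] at this
      simp at this
  -- second longest path
  obtain ⟨L, ⟨hL1, hL2, hL3, m, hL4⟩, hL5, hLmax⟩ := longest
    (fun L => L.Nodup ∧ (∀ x ∈ L, x ∈ T) ∧ pe L ⊆ A ∧ ∃ m, L = m ++ (x :: y :: l').reverse) #T
    (fun L h => hPlen L h.1 h.2.1) (x :: y :: l').reverse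
    ⟨List.nodup_reverse.2 hl1, fun a ha => hl2 a (List.mem_reverse.1 ha), by rwa [pe_reverse], [], rfl⟩
  have hrev : L.reverse = x :: y :: (l' ++ m.reverse) := by
    rw [hL4]; simp
  have hmemL : ∀ a, a ∈ x :: y :: l' → a ∈ L := by
    intro a ha; rw [hL4, List.mem_append, List.mem_reverse]; exact Or.inr ha
  match L, hL5 with
  | [], h => simp at h
  | [_], h => simp at h
  | u :: w :: k, _ =>
  have huT := hL2 u (by simp)
  have hnbu : ∀ z ∈ nb A T u, z ∈ u :: w :: k := by
    intro z hz
    rw [nb, Finset.mem_filter] at hz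
    by_contra hc
    have := hLmax (z :: u :: w :: k) ⟨List.nodup_cons.2 ⟨hc, hL1⟩, by
      intro a ha
      rcases List.mem_cons.1 ha with rfl | ha
      · exact hz.1
      · exact hL2 a ha, by
      rw [pe]; exact Finset.insert_subset (by rw [Sym2.eq_swap]; exact hz.2) hL3,
      z :: m, by rw [hL4]; rfl⟩
    simp at this
  obtain ⟨z, hz, hzw, hne⟩ : ∃ z ∈ nb A T u, z ≠ w ∧ s(u, z) ≠ s(x, z') := by
    cases m with
    | nil =>
      have hu : u = z0 := by
        rw [hl4] at hL4; simp at hL4; exact hL4.1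
      subst hu
      have h1 : 1 < #((nb A T u).erase w) := by
        have := Finset.pred_card_le_card_erase (s := nb A T u) (a := w)
        omega
      obtain ⟨z, hz, hzx⟩ := Finset.exists_mem_ne h1 x
      rw [Finset.mem_erase] at hz
      refine ⟨z, hz.2, hz.1, ?_⟩
      rw [Ne, Sym2.eq_iff]
      rintro (⟨h, _⟩ | ⟨_, h⟩)
      · exact hxz0 h.symm
      · exact hzx h
    | cons u' m =>
      have hu : u = u' := by simp at hL4; exact hL4.1
      subst hu
      obtain ⟨z, hz, hzx⟩ := Finset.exists_mem_ne (by have := hdeg u huT; omega : 1 < #(nb A T u)) w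
      refine ⟨z, hz, hzx, ?_⟩
      have hul : u ∉ x :: y :: l' := by
        rw [hL4, List.cons_append, List.nodup_cons] at hL1
        intro h
        exact hL1.1 (List.mem_append.2 (Or.inr (List.mem_reverse.2 h)))
      rw [Ne, Sym2.eq_iff]
      rintro (⟨h, _⟩ | ⟨h, _⟩)
      · exact hul (by simp [h])
      · exact hul (h ▸ hz'l)
  refine ⟨u :: w :: k, z, z', hL1, fun a ha => hTV (hL2 a ha), hnbu z hz, hmemL _ hz'l,
    u, w, k, x, y, _, hL1, rfl, hrev, hzw, hz'y, hne, hL3, (Finset.mem_filter.1 hz).2, hz'.2⟩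

lemma mem_lst_all {V0 : Finset V} {L : List V} {s : ℕ} (h : ∀ x ∈ L, x ∈ V0) (hs : L.length = s + 1) :
    L ∈ lst V0 V0 s := by
  induction s generalizing L with
  | zero =>
    obtain ⟨a, rfl⟩ := List.length_eq_one_iff.1 hs
    simp only [lst, Finset.mem_image]
    exact ⟨a, h a (by simp), rfl⟩
  | succ s ih =>
    cases L with
    | nil => simp at hs
    | cons x l =>
      simp only [lst, Finset.mem_image, Finset.mem_product, Prod.exists]
      exact ⟨x, l, ⟨h x (by simp), ih (fun y hy => h y (List.mem_cons_of_mem _ hy)) (by simpa using hs)⟩, rfl⟩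

lemma sum_sq_geom {ρ : ℝ} (h0 : 0 ≤ ρ) (h1 : ρ < 1) (N : ℕ) :
    ∑ s ∈ range N, ((s : ℝ) + 1) ^ 2 * ρ ^ s ≤ 2 / (1 - ρ) ^ 3 := by
  have h := hasSum_choose_mul_geometric_of_norm_lt_one 2 (r := ρ) (by rw [Real.norm_eq_abs, abs_of_nonneg h0]; exact h1)
  have h2 := sum_le_hasSum (range N) (fun i _ => by positivity) h
  calc ∑ s ∈ range N, ((s : ℝ) + 1) ^ 2 * ρ ^ s ≤ ∑ s ∈ range N, 2 * (((s + 2).choose 2 : ℕ) * ρ ^ s) := by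
        apply Finset.sum_le_sum
        intro s _
        rw [← mul_assoc]
        apply mul_le_mul_of_nonneg_right _ (by positivity)
        rw [Nat.cast_choose_two]
        push_cast
        have : (0:ℝ) ≤ s := by positivity
        nlinarith
    _ = 2 * ∑ s ∈ range N, (((s + 2).choose 2 : ℕ) * ρ ^ s) := by rw [Finset.mul_sum]
    _ ≤ 2 * (1 / (1 - ρ) ^ (2 + 1)) := by linarith
    _ = _ := by ring

lemma base_case {p ρ : ℝ} (hp0 : 0 ≤ p) (hp1 : p ≤ 1) (V0 : Finset V) (h0 : 0 ≤ ρ) (h1 : ρ < 1)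
    (hρ : #V0 * p ≤ ρ) :
    1 - p * (2 / (1 - ρ) ^ 3) ≤ Ex p (pairs V0) (fun A => ind (NC A)) := by
  have key : Ex p (pairs V0) (fun A => ind (¬ NC A)) ≤ p * (2 / (1 - ρ) ^ 3) := by
    calc Ex p (pairs V0) (fun A => ind (¬ NC A)) ≤
        Ex p (pairs V0) (fun A => ∑ s ∈ range #V0, ∑ L ∈ lst V0 V0 s,
          ∑ q ∈ L.toFinset ×ˢ L.toFinset, ind (Cx A L q.1 q.2)) := by
          apply Ex_mono hp0 hp1
          intro A hA
          by_cases hB : NC A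
          · rw [ind_false (by simpa using hB)]
            exact Finset.sum_nonneg (fun _ _ => Finset.sum_nonneg (fun _ _ => Finset.sum_nonneg (fun _ _ => ind_nonneg _)))
          · rw [ind_true hB]
            obtain ⟨L, z, z', hnd, hV, hz, hz', hC⟩ := not_NC hA hB
            obtain ⟨s, hs⟩ : ∃ s, L.length = s + 1 := by
              cases L with
              | nil => simp at hz
              | cons x l => exact ⟨_, rfl⟩
            have hsV : s < #V0 := by
              have : L.toFinset ⊆ V0 := fun x hx => hV x (List.mem_toFinset.1 hx)
              have := Finset.card_le_card this
              rw [List.toFinset_card_of_nodup hnd] at this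
              omega
            have hL := mem_lst_all hV hs
            rw [← ind_true hC]
            have e1 := Finset.single_le_sum (s := L.toFinset ×ˢ L.toFinset) (a := (z, z')) (f := fun q : V × V => ind (Cx A L q.1 q.2)) (fun _ _ => ind_nonneg _) (by simp [hz, hz'])
            have e2 := Finset.single_le_sum (f := fun L => ∑ q ∈ L.toFinset ×ˢ L.toFinset, ind (Cx A L q.1 q.2))
              (fun _ _ => Finset.sum_nonneg (fun _ _ => ind_nonneg _)) hL
            have e3 := Finset.single_le_sum (f := fun s => ∑ L ∈ lst V0 V0 s, ∑ q ∈ L.toFinset ×ˢ L.toFinset, ind (Cx A L q.1 q.2))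
              (fun _ _ => Finset.sum_nonneg (fun _ _ => Finset.sum_nonneg (fun _ _ => ind_nonneg _)))
              (Finset.mem_range.2 hsV)
            exact e1.trans (e2.trans e3)
      _ = ∑ s ∈ range #V0, ∑ L ∈ lst V0 V0 s,
          ∑ q ∈ L.toFinset ×ˢ L.toFinset, Ex p (pairs V0) (fun A => ind (Cx A L q.1 q.2)) := by
          simp only [Ex_sum]
      _ ≤ ∑ s ∈ range #V0, p * (((s : ℝ) + 1) ^ 2 * ρ ^ s) := by
          apply Finset.sum_le_sum
          intro s _
          calc ∑ L ∈ lst V0 V0 s, ∑ q ∈ L.toFinset ×ˢ L.toFinset, Ex p (pairs V0) (fun A => ind (Cx A L q.1 q.2))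
              ≤ ∑ L ∈ lst V0 V0 s, ((s : ℝ) + 1) ^ 2 * p ^ (s + 2) := by
                apply Finset.sum_le_sum
                intro L hL
                calc ∑ q ∈ L.toFinset ×ˢ L.toFinset, Ex p (pairs V0) (fun A => ind (Cx A L q.1 q.2))
                    ≤ ∑ q ∈ L.toFinset ×ˢ L.toFinset, p ^ (s + 2) := by
                      apply Finset.sum_le_sum
                      rintro ⟨z, z'⟩ _
                      apply Ex_ind_le_of hp0 hp1 _ _ (insert s(L.headD z, z) (insert s(L.reverse.headD z, z') (pe L)))
                      rintro A hA ⟨u, w, m, x, y, k, a1, a2, a3, a4, a5, a6, a7, a8, a9⟩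
                      have b1 : L.headD z = u := by rw [a2]; rfl
                      have b2 : L.reverse.headD z = x := by rw [a3]; rfl
                      rw [b1, b2]
                      refine ⟨Finset.insert_subset a8 (Finset.insert_subset a9 a7), ?_⟩
                      have c1 : s(x, z') ∉ pe L := by
                        rw [← pe_reverse, a3]
                        apply pe_notMem_head _ a5
                        rw [← a3]; exact List.nodup_reverse.2 a1
                      have c2 : s(u, z) ∉ pe L := by
                        rw [a2]
                        apply pe_notMem_head _ a4
                        rw [← a2]; exact a1
                      rw [Finset.card_insert_of_notMem, Finset.card_insert_of_notMem c1, pe_card a1, lst_length hL]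
                      · rfl
                      · rw [Finset.mem_insert]; tauto
                  _ = (#L.toFinset : ℝ) ^ 2 * p ^ (s + 2) := by
                      rw [Finset.sum_const, Finset.card_product, nsmul_eq_mul]; push_cast; ring
                  _ ≤ _ := by
                      apply mul_le_mul_of_nonneg_right _ (by positivity)
                      have h2 := L.toFinset_card_le
                      rw [lst_length hL] at h2
                      apply pow_le_pow_left₀ (by positivity)
                      exact_mod_cast h2
            _ = #(lst V0 V0 s) * (((s : ℝ) + 1) ^ 2 * p ^ (s + 2)) := by simp
            _ ≤ ((#V0 : ℝ) ^ s * #V0) * (((s : ℝ) + 1) ^ 2 * p ^ (s + 2)) := by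
                apply mul_le_mul_of_nonneg_right _ (by positivity)
                exact_mod_cast lst_card V0 V0 s
            _ = (((s : ℝ) + 1) ^ 2 * p) * (#V0 * p) ^ (s + 1) := by rw [mul_pow]; ring
            _ ≤ (((s : ℝ) + 1) ^ 2 * p) * ρ ^ s := by
                apply mul_le_mul_of_nonneg_left _ (by positivity)
                calc (#V0 * p) ^ (s + 1) ≤ ρ ^ (s + 1) := pow_le_pow_left₀ (by positivity) hρ _
                  _ ≤ ρ ^ s := pow_le_pow_of_le_one h0 h1.le (by omega)
            _ = _ := by ring
      _ = p * ∑ s ∈ range #V0, (((s : ℝ) + 1) ^ 2 * ρ ^ s) := by rw [Finset.mul_sum]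
      _ ≤ _ := mul_le_mul_of_nonneg_left (sum_sq_geom h0 h1 _) hp0
  have h2 : Ex p (pairs V0) (fun A => ind (¬ NC A)) = 1 - Ex p (pairs V0) (fun A => ind (NC A)) := by
    simp only [ind_not]; rw [Ex_sub, Ex_const]
  linarith

end Base
end CG

namespace CG
open Finset
open scoped Classical
section Num

/-- basic numerical facts -/
lemma p_facts {a1 t p : ℝ} {n : ℕ} (ha : 0 ≤ a1) (ht : 2 * (a1 + 2) ≤ t) (hn : t ^ 3 = n)
    (hp : p = (1 + a1 / t) / n) :
    0 < t ∧ (0:ℝ) < n ∧ 0 ≤ p ∧ p ≤ 2 / n ∧ 1 / n ≤ p ∧ p < 1 ∧ n * p = 1 + a1 / t := by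
  have t0 : 0 < t := by linarith
  have n0 : (0:ℝ) < n := by rw [← hn]; positivity
  have h1 : a1 / t ≤ 1 := by rw [div_le_one t0]; linarith
  have h2 : 0 ≤ a1 / t := by positivity
  have n64 : (64:ℝ) ≤ n := by
    rw [← hn]
    calc (64:ℝ) = 4 ^ 3 := by norm_num
      _ ≤ t ^ 3 := pow_le_pow_left₀ (by norm_num) (by linarith) 3
  refine ⟨t0, n0, by rw [hp]; positivity, ?_, ?_, ?_, ?_⟩
  · rw [hp]; gcongr; linarith
  · rw [hp]; gcongr; linarith
  · rw [hp, div_lt_one n0]; linarith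
  · rw [hp]; field_simp

lemma bad_bound {V : Type*} [DecidableEq V] {a1 t p κ : ℝ} {n : ℕ} (ha : 0 ≤ a1) (ht : 2 * (a1 + 2) ≤ t)
    (hn : t ^ 3 = n) (hp : p = (1 + a1 / t) / n) (hκ : 1 ≤ κ) (V0 Γ : Finset V) (P : Finset (Sym2 V))
    (hV : #V0 ≤ n) (hΓ : Γ ⊆ V0) (hΓt : (#Γ : ℝ) ≤ t) :
    Ex p (pairs V0) (fun A => ind (Bad A P V0 Γ ⌊t⌋₊ (κ * t ^ 2))) ≤ 13 * Real.exp (a1 + 1) * #Γ / t := by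
  obtain ⟨t0, n0, p0, p2, -, p1, hnp⟩ := p_facts ha ht hn hp
  set c := Real.exp (a1 + 1) with hc
  have c1 : 1 ≤ c := Real.one_le_exp (by linarith)
  set h := ⌊t⌋₊ with hh
  have hht : (h : ℝ) ≤ t := Nat.floor_le t0.le
  have hht2 : t / 2 ≤ h := by
    have := Nat.lt_floor_add_one t
    rw [← hh] at this
    linarith
  have h0 : (0:ℝ) < h := by linarith
  set g : ℝ := ((#Γ : ℕ) : ℝ) with hg
  have g0 : 0 ≤ g := by positivity
  set θ := 1 + (a1 + 1) / t with hθ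
  have hθ1 : 1 ≤ θ := by rw [hθ]; have : 0 ≤ (a1+1)/t := by positivity
                         linarith
  have hθ2 : θ ≤ 3 / 2 := by
    have : (a1 + 1) / t ≤ 1 / 2 := by rw [div_le_iff₀ t0]; linarith
    linarith
  have t3 : 3 ≤ t ^ 2 := by nlinarith
  have pt : p ≤ 2 / t ^ 3 := by rw [hn]; exact p2
  have hθp : n * p ≤ θ * (1 - p) := by
    have h1 : θ * p ≤ 1 / t := by
      calc θ * p ≤ (3/2) * (2 / t ^ 3) := by gcongr
        _ = 3 / t ^ 2 / t := by field_simp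
        _ ≤ 1 / t := by gcongr; rw [div_le_one (by positivity)]; exact t3
    have : θ = 1 + a1 / t + 1 / t := by rw [hθ]; ring
    rw [hnp]; linarith
  have hpow : ∀ s : ℕ, s ≤ h → θ ^ s ≤ c := by
    intro s hs
    calc θ ^ s ≤ Real.exp ((a1+1)/t) ^ s := by
          apply pow_le_pow_left₀ (by linarith)
          rw [hθ, add_comm]; exact Real.add_one_le_exp _
      _ = Real.exp (s * ((a1+1)/t)) := by rw [Real.exp_nat_mul]
      _ ≤ c := by
          apply Real.exp_le_exp.2
          have : (s:ℝ) ≤ t := le_trans (by exact_mod_cast hs) hht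
          rw [← mul_div_assoc, div_le_iff₀ t0]
          nlinarith
  have hnpow : ∀ s : ℕ, s ≤ h → ((n:ℝ) * p) ^ s ≤ c := by
    intro s hs
    refine le_trans (pow_le_pow_left₀ (by positivity) ?_ s) (hpow s hs)
    rw [hnp, hθ]; gcongr; linarith
  have hQ : Q p n h ≤ 6 * c / t := by
    have := Q_bound n p0 p1 hθ1 hθ2 hθp h
    have h2 := hpow h le_rfl
    have hq := (Q_mem p0 p1.le n h).1
    rw [le_div_iff₀ t0]
    nlinarith
  have hb := prob_Bad p0 p1.le V0 Γ P hΓ n h hV (K := κ * t ^ 2) (by positivity)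
  rw [← hg] at hb
  have e1 : g ^ 2 * p ≤ 2 * c * g / t := by
    calc g ^ 2 * p ≤ (g * t) * (2 / t ^ 3) := by
          rw [pow_two]; gcongr
      _ = 2 * 1 * g / t / t := by field_simp
      _ ≤ 2 * c * g / t / 1 := by gcongr; linarith
      _ = _ := by rw [div_one]
  have e2 : g * Q p n h ≤ 6 * c * g / t := by
    calc g * Q p n h ≤ g * (6 * c / t) := by gcongr
      _ = _ := by ring
  have e3 : ∑ s ∈ range h, (n : ℝ) ^ s * g * (g + s + 1) * p ^ (s + 1) ≤ 4 * c * g / t := by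
    calc ∑ s ∈ range h, (n : ℝ) ^ s * g * (g + s + 1) * p ^ (s + 1)
        ≤ ∑ s ∈ range h, c * g * (2 * t) * (2 / t ^ 3) := by
          apply Finset.sum_le_sum
          intro s hs
          have hs' := Finset.mem_range.1 hs
          have hs1 : (s : ℝ) + 1 ≤ h := by exact_mod_cast hs'
          calc (n : ℝ) ^ s * g * (g + s + 1) * p ^ (s + 1) = (n * p) ^ s * g * (g + s + 1) * p := by
                rw [mul_pow]; ring
            _ ≤ c * g * (2 * t) * (2 / t ^ 3) := by
                gcongr
                · exact hnpow s hs'.le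
                · linarith
      _ = h * (c * g * (2 * t) * (2 / t ^ 3)) := by simp
      _ ≤ t * (c * g * (2 * t) * (2 / t ^ 3)) := by gcongr
      _ = _ := by field_simp; ring
  have e4 : (∑ s ∈ range h, g * ((n : ℝ) * p) ^ s) / (κ * t ^ 2) ≤ c * g / t := by
    calc (∑ s ∈ range h, g * ((n : ℝ) * p) ^ s) / (κ * t ^ 2) ≤ (∑ s ∈ range h, g * c) / (1 * t ^ 2) := by
          gcongr with s hs
          exact hnpow s (Finset.mem_range.1 hs).le
      _ = h * (g * c) / t ^ 2 := by simp
      _ ≤ t * (g * c) / t ^ 2 := by gcongr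
      _ = _ := by field_simp
  calc _ ≤ _ := hb
    _ ≤ 2 * c * g / t + 6 * c * g / t + 4 * c * g / t + c * g / t := by gcongr
    _ = _ := by ring

lemma step_bounds {V : Type*} [DecidableEq V] [Fintype V] {a1 t p ε : ℝ} {n : ℕ} (ha : 0 ≤ a1)
    (hε : ε = 1 / (26 * Real.exp (a1 + 1)))
    (ht : 2 * (a1 + 2) ≤ t) (htε : 2 ≤ ε * t)
    (hn : t ^ 3 = n) (hp : p = (1 + a1 / t) / n) (V0 : Finset V) (v : V) (hv : v ∈ V0)
    (hV : #V0 ≤ n) (hV' : n - (a1 + 2) * t ^ 2 ≤ #V0) :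
    1 - 13 * Real.exp (a1 + 1) / t ≤ Ex p (pairs V0) (fun A => ind (Good A v ((a1 + 2) * t ^ 2))) ∧
    ε * t / 8 ≤ Ex p (pairs V0) (fun A => ind (Good A v ((a1 + 2) * t ^ 2)) * #(Comp A v)) := by
  obtain ⟨t0, n0, p0, p2, pn, p1, hnp⟩ := p_facts ha ht hn hp
  set c := Real.exp (a1 + 1) with hc
  have c1 : a1 + 2 ≤ c := by have := Real.add_one_le_exp (a1 + 1); linarith
  have c0 : 0 < c := Real.exp_pos _
  have ε0 : 0 < ε := by rw [hε]; positivity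
  have ε1 : ε ≤ 1 := by rw [hε, div_le_one (by positivity)]; linarith
  have εc : ε * c = 1 / 26 := by rw [hε]; field_simp
  constructor
  · have h1 := good_prob (v := v) p0 p1.le (V0 := V0) ⌊t⌋₊ ((a1 + 2) * t ^ 2)
    have h2 := bad_bound ha ht hn hp (κ := a1 + 2) (by linarith) V0 [v].toFinset (pe [v]) hV
      (by simpa using hv) (by simp; linarith)
    simp only [List.toFinset_cons, List.toFinset_nil, insert_empty_eq, Finset.card_singleton, Nat.cast_one, mul_one] at h1 h2
    linarith
  · set R := ⌊ε * t⌋₊ with hR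
    have hRt : (R : ℝ) ≤ ε * t := Nat.floor_le (by positivity)
    have hRt2 : ε * t / 2 ≤ R := by
      have := Nat.lt_floor_add_one (ε * t)
      rw [← hR] at this
      linarith
    have hRt3 : (R : ℝ) ≤ t := by nlinarith
    refine le_trans ?_ (comp_lower p0 p1.le hv R ⌊t⌋₊ ((a1 + 2) * t ^ 2) ?_)
    · have hx : 1 - (a1 + 3) / t ≤ ((#V0 - R : ℕ) : ℝ) * p := by
        have h1 : (#V0 : ℝ) - R ≤ ((#V0 - R : ℕ) : ℝ) := by
          have : #V0 ≤ (#V0 - R) + R := by omega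
          have : (#V0 : ℝ) ≤ ((#V0 - R : ℕ) : ℝ) + R := by exact_mod_cast this
          linarith
        calc 1 - (a1 + 3) / t ≤ (n - (a1 + 2) * t ^ 2 - t) * (1 / n) := by
              rw [← hn]
              have : (t ^ 3 - (a1 + 2) * t ^ 2 - t) * (1 / t ^ 3) = 1 - (a1 + 2) / t - 1 / t / t := by
                field_simp
              rw [this]
              have h2 : 1 / t / t ≤ 1 / t := div_le_self (by positivity) (by linarith)
              have h3 : (a1 + 3) / t = (a1 + 2) / t + 1 / t := by ring
              linarith
          _ ≤ ((#V0 - R : ℕ) : ℝ) * (1 / n) := by gcongr; linarith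
          _ ≤ _ := by gcongr
      have hx2 : (a1 + 3) / t ≤ 1 := by rw [div_le_one t0]; linarith
      have hx3 : 0 ≤ (a1 + 3) / t := by positivity
      have hr : ∀ r ∈ range R, (1:ℝ) / 4 ≤ (((#V0 - R : ℕ) : ℝ) * p) ^ r / 2 := by
        intro r hr
        have hrR : (r : ℝ) ≤ R := by exact_mod_cast (Finset.mem_range.1 hr).le
        have b1 := one_add_mul_le_pow (a := -((a1 + 3) / t)) (by linarith) r
        have b2 : (1 + -((a1 + 3) / t)) ^ r ≤ (((#V0 - R : ℕ) : ℝ) * p) ^ r :=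
          pow_le_pow_left₀ (by linarith) (by linarith) r
        have b3 : r * ((a1 + 3) / t) ≤ 1 / 2 := by
          calc r * ((a1 + 3) / t) ≤ (ε * t) * ((2 * c) / t) := by
                gcongr
                · linarith
                · linarith
            _ = 2 * (ε * c) := by field_simp
            _ ≤ 1 / 2 := by rw [εc]; norm_num
        linarith
      calc ε * t / 8 ≤ R * (1 / 4) := by linarith
        _ = ∑ r ∈ range R, (1:ℝ)/4 := by simp
        _ ≤ _ := Finset.sum_le_sum hr
    · intro l hl hlV hl1 hlR
      have hcard : #l.toFinset = l.length := List.toFinset_card_of_nodup hl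
      have hlR' : (l.length : ℝ) ≤ R := by exact_mod_cast hlR
      have h2 := bad_bound ha ht hn hp (κ := a1 + 2) (by linarith) V0 l.toFinset (pe l) hV
        (fun x hx => hlV x (List.mem_toFinset.1 hx)) (by rw [hcard]; linarith)
      refine h2.trans ?_
      rw [hcard]
      calc 13 * c * l.length / t ≤ 13 * c * (ε * t) / t := by gcongr; linarith
        _ = 13 * (ε * c) := by field_simp
        _ = 1 / 2 := by rw [εc]; norm_num

lemma main_p (a1 : ℝ) (ha : 0 ≤ a1) : ∃ b : ℝ, 0 < b ∧ ∃ T0 : ℝ, ∀ (n : ℕ) (t : ℝ), T0 ≤ t → t ^ 3 = n →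
    b ≤ Ex ((1 + a1 / t) / n) (pairs (Finset.univ : Finset (Fin n))) (fun A => ind (NC A)) := by
  set c := Real.exp (a1 + 1) with hc
  have c0 : 0 < c := Real.exp_pos _
  set ε := 1 / (26 * c) with hε
  have ε0 : 0 < ε := by positivity
  set κ := a1 + 2 with hκ
  have κ0 : 0 < κ := by linarith
  set D := 104 * c / ε with hD
  have D0 : 0 < D := by positivity
  refine ⟨1 / 2 * Real.exp (-(2 * D * κ)), by positivity, max (2 * (a1 + 2)) (2 / ε), ?_⟩
  intro n t hT hn
  have ht : 2 * (a1 + 2) ≤ t := (le_max_left _ _).trans hT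
  have htε : 2 ≤ ε * t := by
    have := (le_max_right _ _).trans hT
    rw [div_le_iff₀ ε0] at this; linarith
  set p := (1 + a1 / t) / n with hp
  obtain ⟨t0, n0, p0, p2, pn, p1, hnp⟩ := p_facts ha ht hn hp
  set f : ℝ → ℝ := fun k => 1 / 2 * Real.exp (-(2 * D * κ)) * Real.exp (D * k / t ^ 2) with hf
  have f0 : ∀ k, 0 < f k := fun k => by positivity
  have claim : ∀ N : ℕ, ∀ V0 : Finset (Fin n), #V0 = N → (n : ℝ) - 2 * κ * t ^ 2 ≤ #V0 →
      f (n - #V0) ≤ Ex p (pairs V0) (fun A => ind (NC A)) := by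
    intro N
    induction N using Nat.strong_induction_on with
    | _ N ih =>
    intro V0 hN hV2
    have hVn : #V0 ≤ n := by simpa using Finset.card_le_univ V0
    by_cases hcase : (#V0 : ℝ) ≤ n - κ * t ^ 2
    · have hρ : (#V0 : ℝ) * p ≤ 1 - 2 / t := by
        calc (#V0 : ℝ) * p ≤ (n - κ * t ^ 2) * p := by gcongr
          _ = (n * p) * (1 - κ / t) := by rw [← hn]; field_simp
          _ = 1 - 2 / t - a1 / t * (κ / t) := by rw [hnp, hκ]; ring
          _ ≤ 1 - 2 / t := by
              have : 0 ≤ a1 / t * (κ / t) := by positivity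
              linarith
      have ht2 : 2 / t ≤ 1 := by rw [div_le_one t0]; linarith
      have ht3 : 0 < 2 / t := by positivity
      have hb := base_case p0 p1.le V0 (ρ := 1 - 2 / t) (by linarith) (by linarith) hρ
      refine le_trans ?_ hb
      have h1 : p * (2 / (1 - (1 - 2 / t)) ^ 3) ≤ 1 / 2 := by
        calc p * (2 / (1 - (1 - 2 / t)) ^ 3) = p * (t ^ 3 / 4) := by
              rw [sub_sub_cancel]; field_simp; norm_num
          _ ≤ (2 / n) * (t ^ 3 / 4) := by gcongr
          _ = 1 / 2 := by rw [hn]; field_simp; norm_num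
      have h2 : f (n - #V0) ≤ 1 / 2 := by
        rw [hf]
        simp only
        rw [mul_assoc, ← Real.exp_add]
        have : Real.exp (-(2 * D * κ) + D * (n - #V0) / t ^ 2) ≤ 1 := by
          rw [Real.exp_le_one_iff]
          have : D * (n - #V0) / t ^ 2 ≤ 2 * D * κ := by
            rw [div_le_iff₀ (by positivity)]
            nlinarith
          linarith
        linarith
      linarith
    · push Not at hcase
      have hVpos : (0:ℝ) < #V0 := by
        have : κ * t ^ 2 ≤ n := by
          rw [← hn]
          have : κ ≤ t := by linarith
          calc κ * t ^ 2 ≤ t * t ^ 2 := by gcongr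
            _ = t ^ 3 := by ring
        linarith
      obtain ⟨v, hv⟩ := Finset.card_pos.1 (by exact_mod_cast hVpos : 0 < #V0)
      obtain ⟨g1, g2⟩ := step_bounds ha hε ht htε hn hp V0 v hv hVn hcase.le
      have hrec := recursion p0 p1.le V0 v hv (κ * t ^ 2) (fun k => f (n - #V0 + k)) (fun k => (f0 _).le) (by
        intro S hS hvS hSK
        have hcs : #(V0 \ S) + #S = #V0 := Finset.card_sdiff_add_card_eq_card hS
        have hcs' : (#(V0 \ S) : ℝ) + #S = #V0 := by exact_mod_cast hcs
        have hSpos : 0 < #S := Finset.card_pos.2 ⟨v, hvS⟩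
        have := ih #(V0 \ S) (by omega) (V0 \ S) rfl (by linarith)
        have e : (n : ℝ) - #V0 + #S = n - #(V0 \ S) := by linarith
        simp only [e]
        exact this)
      refine le_trans ?_ hrec
      calc f (n - #V0) = f (n - #V0) * 1 := (mul_one _).symm
        _ ≤ f (n - #V0) * (Ex p (pairs V0) (fun A => ind (Good A v (κ * t ^ 2))) +
              D / t ^ 2 * Ex p (pairs V0) (fun A => ind (Good A v (κ * t ^ 2)) * #(Comp A v))) := by
            apply mul_le_mul_of_nonneg_left _ (f0 _).le
            have : 13 * c / t ≤ D / t ^ 2 * Ex p (pairs V0) (fun A => ind (Good A v (κ * t ^ 2)) * #(Comp A v)) := by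
              calc 13 * c / t = D / t ^ 2 * (ε * t / 8) := by
                    rw [hD]; field_simp; norm_num
                _ ≤ _ := by gcongr
            linarith
        _ = Ex p (pairs V0) (fun A => f (n - #V0) * (ind (Good A v (κ * t ^ 2)) +
              D / t ^ 2 * (ind (Good A v (κ * t ^ 2)) * #(Comp A v)))) := by
            rw [Ex_mul, Ex_add, Ex_mul]
        _ ≤ _ := by
            apply Ex_mono p0 p1.le
            intro A _
            have hfe : f (n - #V0 + #(Comp A v)) = f (n - #V0) * Real.exp (D * #(Comp A v) / t ^ 2) := by
              simp only [hf]
              have e0 : D * (n - #V0 + #(Comp A v)) / t ^ 2 = D * (n - #V0) / t ^ 2 + D * #(Comp A v) / t ^ 2 := by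
                ring
              rw [e0, Real.exp_add]; ring
            simp only [hfe]
            have := Real.add_one_le_exp (D * #(Comp A v) / t ^ 2)
            have e : f (n - #V0) * (ind (Good A v (κ * t ^ 2)) +
              D / t ^ 2 * (ind (Good A v (κ * t ^ 2)) * #(Comp A v))) =
              (ind (Good A v (κ * t ^ 2)) * f (n - #V0)) * (D * #(Comp A v) / t ^ 2 + 1) := by ring
            rw [e]
            refine (mul_le_mul_of_nonneg_left this (mul_nonneg (ind_nonneg _) (f0 _).le)).trans (le_of_eq ?_)
            ring
  have := claim _ (Finset.univ : Finset (Fin n)) rfl (by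
    simp; positivity)
  simp [hf] at this
  simpa using this

end Num
end CG

namespace CG
open Finset
open scoped Classical
section Transfer

lemma Ex_sq {α : Type*} [DecidableEq α] (p : ℝ) (E : Finset α) (c : ℝ) :
    Ex p E (fun A => ((#A : ℝ) - c) ^ 2) = #E * p * (1 - p) + (#E * p - c) ^ 2 := by
  induction E using Finset.induction_on generalizing c with
  | empty => simp [Ex_empty]
  | insert e E he ih =>
    rw [Ex_insert p he, ih]
    have h1 : Ex p E (fun A => ((#(insert e A) : ℝ) - c) ^ 2) = Ex p E (fun A => ((#A : ℝ) - (c - 1)) ^ 2) := by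
      apply Ex_congr
      intro A hA
      rw [Finset.card_insert_of_notMem (fun h => he (hA h))]
      push_cast
      ring
    rw [h1, ih, Finset.card_insert_of_notMem he]
    push_cast
    ring

lemma Ex_lower_tail {α : Type*} [DecidableEq α] {p : ℝ} (p0 : 0 ≤ p) (p1 : p ≤ 1) (E : Finset α) (m : ℕ)
    {d : ℝ} (hd : 0 < d) (h : (m : ℝ) + d ≤ #E * p) :
    Ex p E (fun A => ind (#A < m)) ≤ #E * p / d ^ 2 := by
  calc Ex p E (fun A => ind (#A < m)) ≤ Ex p E (fun A => (1 / d ^ 2) * ((#A : ℝ) - #E * p) ^ 2) := by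
        apply Ex_mono p0 p1
        intro A _
        by_cases hA : #A < m
        · rw [ind_true hA, one_div, ← div_eq_inv_mul, le_div_iff₀ (by positivity)]
          have : (#A : ℝ) < m := by exact_mod_cast hA
          nlinarith
        · rw [ind_false hA]; positivity
    _ = (1 / d ^ 2) * (#E * p * (1 - p)) := by
        rw [Ex_mul, Ex_sq]; ring
    _ ≤ (1 / d ^ 2) * (#E * p * 1) := by
        gcongr; linarith
    _ = _ := by ring

variable {V : Type*} [DecidableEq V]

lemma NC.mono {A B : Finset (Sym2 V)} (h : A ⊆ B) (hB : NC B) : NC A := fun T =>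
  (Finset.card_le_card (Finset.inter_subset_inter_right h)).trans (hB T)

/-- noncomplex edge sets of size `j` -/
noncomputable def NCs (E : Finset (Sym2 V)) (j : ℕ) : Finset (Finset (Sym2 V)) :=
  (E.powersetCard j).filter NC

lemma NCs_step (E : Finset (Sym2 V)) {i j : ℕ} (hij : i ≤ j) :
    #(NCs E j) * j.choose i ≤ #(NCs E i) * (#E - i).choose (j - i) := by
  apply Finset.card_mul_le_card_mul (fun A B => B ⊆ A)
  · intro A hA
    simp only [NCs, mem_filter, mem_powersetCard] at hA
    rw [← hA.1.2, ← Finset.card_powersetCard]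
    apply Finset.card_le_card
    intro B hB
    rw [mem_powersetCard] at hB
    simp only [mem_bipartiteAbove, NCs, mem_filter, mem_powersetCard]
    exact ⟨⟨⟨hB.1.trans hA.1.1, hB.2⟩, hA.2.mono hB.1⟩, hB.1⟩
  · intro B hB
    simp only [NCs, mem_filter, mem_powersetCard] at hB
    have : #(E \ B) = #E - i := by rw [card_sdiff_of_subset hB.1.1, hB.1.2]
    rw [← this, ← Finset.card_powersetCard]
    apply Finset.card_le_card_of_injOn (fun A => A \ B)
    · intro A hA
      simp only [coe_filter, Finset.bipartiteBelow, NCs, mem_filter, mem_powersetCard, Set.mem_ofPred_eq] at hA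
      simp only [mem_coe, mem_powersetCard]
      refine ⟨Finset.sdiff_subset_sdiff hA.1.1.1 le_rfl, ?_⟩
      rw [card_sdiff_of_subset hA.2, hA.1.1.2, hB.1.2]
    · intro A hA A' hA' h
      simp only [coe_filter, Finset.bipartiteBelow, Set.mem_ofPred_eq] at hA hA'
      simp only at h
      rw [← Finset.sdiff_union_of_subset hA.2, h, Finset.sdiff_union_of_subset hA'.2]

lemma NCs_anti (E : Finset (Sym2 V)) {i j : ℕ} (hij : i ≤ j) (hj : j ≤ #E) :
    #(NCs E j) * (#E).choose i ≤ #(NCs E i) * (#E).choose j := by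
  have h := NCs_step E hij
  have h2 := Nat.choose_mul (n := #E) hij
  have h3 : 0 < j.choose i := Nat.choose_pos hij
  apply Nat.le_of_mul_le_mul_right _ h3
  calc #(NCs E j) * (#E).choose i * j.choose i = #(NCs E j) * j.choose i * (#E).choose i := by ring
    _ ≤ #(NCs E i) * (#E - i).choose (j - i) * (#E).choose i := by gcongr
    _ = #(NCs E i) * ((#E).choose i * (#E - i).choose (j - i)) := by ring
    _ = _ := by rw [← h2]; ring

lemma transfer {p : ℝ} (p0 : 0 ≤ p) (p1 : p ≤ 1) (E : Finset (Sym2 V)) {m : ℕ} (hm : m ≤ #E) :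
    Ex p E (fun A => ind (NC A)) ≤ #(NCs E m) / (#E).choose m + Ex p E (fun A => ind (#A < m)) := by
  have q0 : 0 ≤ 1 - p := by linarith
  have cpos : (0:ℝ) < (#E).choose m := by exact_mod_cast Nat.choose_pos hm
  have key : Ex p E (fun A => ind (m ≤ #A) * ind (NC A)) ≤ #(NCs E m) / (#E).choose m := by
    calc Ex p E (fun A => ind (m ≤ #A) * ind (NC A)) 
        ≤ Ex p E (fun _ => (#(NCs E m) : ℝ) / (#E).choose m) := by
          unfold Ex
          rw [Finset.sum_powerset, Finset.sum_powerset]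
          apply Finset.sum_le_sum
          intro j hj
          rw [mem_range] at hj
          have e1 : ∑ A ∈ E.powersetCard j, p ^ #A * (1 - p) ^ #(E \ A) * (ind (m ≤ #A) * ind (NC A)) =
              p ^ j * (1 - p) ^ (#E - j) * (ind (m ≤ j) * #(NCs E j)) := by
            rw [NCs, Finset.card_filter]
            push_cast
            rw [Finset.mul_sum, Finset.mul_sum]
            apply Finset.sum_congr rfl
            intro A hA
            rw [mem_powersetCard] at hA
            rw [card_sdiff_of_subset hA.1, hA.2]
            rfl
          have e2 : ∑ A ∈ E.powersetCard j, p ^ #A * (1 - p) ^ #(E \ A) * ((#(NCs E m) : ℝ) / (#E).choose m) =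
              p ^ j * (1 - p) ^ (#E - j) * ((#E).choose j * ((#(NCs E m) : ℝ) / (#E).choose m)) := by
            rw [← Finset.card_powersetCard j E, ← nsmul_eq_mul (#(powersetCard j E)), ← Finset.sum_const, Finset.mul_sum]
            apply Finset.sum_congr rfl
            intro A hA
            rw [mem_powersetCard] at hA
            rw [card_sdiff_of_subset hA.1, hA.2]
          rw [e1, e2]
          apply mul_le_mul_of_nonneg_left _ (by positivity)
          by_cases hmj : m ≤ j
          · rw [ind_true hmj, one_mul, ← mul_div_assoc, le_div_iff₀ cpos]
            have := NCs_anti E hmj (by omega)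
            rw [mul_comm ((#E).choose j : ℝ)]
            exact_mod_cast this
          · rw [ind_false hmj, zero_mul]; positivity
      _ = _ := Ex_const _ _ _
  calc Ex p E (fun A => ind (NC A)) ≤ Ex p E (fun A => ind (m ≤ #A) * ind (NC A) + ind (#A < m)) := by
        apply Ex_mono p0 p1
        intro A _
        by_cases h : m ≤ #A
        · rw [ind_true h, one_mul]; linarith [ind_nonneg (#A < m)]
        · rw [ind_false h, ind_true (not_le.1 h)]; linarith [ind_le_one (NC A)]
    _ ≤ _ := by rw [Ex_add]; linarith

lemma card_pairs_univ (n : ℕ) : #(pairs (Finset.univ : Finset (Fin n))) = n.choose 2 := by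
  have h := Sym2.card_subtype_not_diag (α := Fin n)
  rw [Fintype.card_fin] at h
  rw [← h, Fintype.card_subtype]
  unfold pairs
  congr 1

lemma NCs_le_Ucard (n m : ℕ) : #(NCs (pairs (Finset.univ : Finset (Fin n))) m) ≤ Ucard n m := by
  have hE : ∀ A ∈ NCs (pairs (Finset.univ : Finset (Fin n))) m,
      (SimpleGraph.fromEdgeSet (A : Set (Sym2 (Fin n)))).edgeSet = A := by
    intro A hA
    simp only [NCs, mem_filter, mem_powersetCard] at hA
    rw [SimpleGraph.edgeSet_fromEdgeSet]
    ext e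
    simp only [Set.mem_sdiff, mem_coe, Set.mem_ofPred_eq]
    constructor
    · exact fun h => h.1
    · intro h
      refine ⟨h, ?_⟩
      have := hA.1.1 h
      simp only [pairs, mem_filter] at this
      exact this.2
  have hm : ∀ A ∈ NCs (pairs (Finset.univ : Finset (Fin n))) m,
      (SimpleGraph.fromEdgeSet (A : Set (Sym2 (Fin n)))).edgeSet.ncard = m ∧
      NonComplex (SimpleGraph.fromEdgeSet (A : Set (Sym2 (Fin n)))) := by
    intro A hA
    have hA' := hA
    simp only [NCs, mem_filter, mem_powersetCard] at hA'
    refine ⟨by rw [hE A hA, Set.ncard_coe_finset, hA'.1.2], ?_⟩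
    intro c
    have h1 := hA'.2 c.supp.toFinset
    have h2 : {e : Sym2 (Fin n) | e ∈ (SimpleGraph.fromEdgeSet (A : Set (Sym2 (Fin n)))).edgeSet ∧
        ∀ v ∈ e, v ∈ c.supp} = ((A ∩ c.supp.toFinset.sym2 : Finset (Sym2 (Fin n))) : Set (Sym2 (Fin n))) := by
      rw [hE A hA]
      ext e
      simp only [Set.mem_ofPred_eq, mem_coe, mem_inter, Finset.mem_sym2_iff, Set.mem_toFinset]
    rw [h2, Set.ncard_coe_finset, Set.ncard_eq_toFinset_card']
    exact h1
  rw [Ucard, ← Nat.card_eq_finsetCard]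
  refine Nat.card_le_card_of_injective (fun A : NCs (pairs (Finset.univ : Finset (Fin n))) m =>
    (⟨SimpleGraph.fromEdgeSet ((A : Finset (Sym2 (Fin n))) : Set (Sym2 (Fin n))), hm A.1 A.2⟩ :
      {G : SimpleGraph (Fin n) // G.edgeSet.ncard = m ∧ NonComplex G})) ?_
  intro A B h
  have h' : SimpleGraph.fromEdgeSet ((A : Finset (Sym2 (Fin n))) : Set (Sym2 (Fin n))) =
      SimpleGraph.fromEdgeSet ((B : Finset (Sym2 (Fin n))) : Set (Sym2 (Fin n))) := congrArg Subtype.val h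
  have h'' := congrArg SimpleGraph.edgeSet h'
  rw [hE A.1 A.2, hE B.1 B.2] at h''
  exact Subtype.ext (by exact_mod_cast h'')

lemma final (a : ℝ) :
    ∃ b : ℝ, 0 < b ∧ ∃ N : ℕ, ∀ n : ℕ, N ≤ n → ∀ m : ℕ,
      (2 * m : ℝ) - n ≤ a * (n : ℝ) ^ ((2 : ℝ) / 3) →
      b * ((n.choose 2).choose m : ℝ) ≤ (Ucard n m : ℝ) := by
  set a1 := max a 0 + 2 with ha1
  have h0 : 0 ≤ a1 := by have := le_max_right a 0; linarith
  have haa : a + 2 ≤ a1 := by have := le_max_left a 0; linarith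
  obtain ⟨b, hb, T0, hT⟩ := main_p a1 h0
  set T := max T0 (max (2 * (a1 + 2)) (8 / b)) with hTd
  have hT1 : T0 ≤ T := le_max_left _ _
  have hT2 : 2 * (a1 + 2) ≤ T := (le_max_left _ _).trans (le_max_right _ _)
  have hT3 : 8 / b ≤ T := (le_max_right _ _).trans (le_max_right _ _)
  have T0' : 0 ≤ T := by linarith
  refine ⟨b / 2, by positivity, ⌈T ^ 3⌉₊, ?_⟩
  intro n hn m hm
  have hnT : T ^ 3 ≤ n := Nat.ceil_le.1 hn
  set t : ℝ := (n : ℝ) ^ ((1 : ℝ) / 3) with ht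
  have ht3 : t ^ 3 = n := by
    rw [ht, ← Real.rpow_natCast, ← Real.rpow_mul (by positivity)]; norm_num
  have ht2 : (n : ℝ) ^ ((2 : ℝ) / 3) = t ^ 2 := by
    rw [ht, ← Real.rpow_natCast, ← Real.rpow_mul (by positivity)]; norm_num
  have htn : 0 ≤ t := by positivity
  have hTt : T ≤ t := by
    rw [← ht3] at hnT
    exact le_of_pow_le_pow_left₀ (by norm_num) htn hnT
  rcases lt_or_ge (n.choose 2) m with hlt | hle
  · rw [Nat.choose_eq_zero_of_lt hlt]; simp
  set p := (1 + a1 / t) / n with hp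
  obtain ⟨t0, n0, p0, -, -, p1, hnp⟩ := p_facts h0 (hT2.trans hTt) ht3 hp
  have hmain := hT n t (hT1.trans hTt) ht3
  have hcard := card_pairs_univ n
  have htr := transfer p0 p1.le (pairs (Finset.univ : Finset (Fin n))) (m := m) (by rw [hcard]; exact hle)
  have hNp : (#(pairs (Finset.univ : Finset (Fin n))) : ℝ) * p = (n - 1) * (1 + a1 / t) / 2 := by
    rw [hcard, Nat.cast_choose_two, ← hnp]; ring
  have hat : a1 / t ≤ 1 := by rw [div_le_one t0]; linarith
  have hat0 : 0 ≤ a1 / t := by positivity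
  have ht4 : 4 ≤ t := by linarith
  have htail := Ex_lower_tail p0 p1.le (pairs (Finset.univ : Finset (Fin n))) m (d := t ^ 2 / 2) (by positivity) (by
    rw [hNp]
    rw [ht2] at hm
    rw [← ht3] at hm ⊢
    have e : (t ^ 3 - 1) * (1 + a1 / t) = t ^ 3 + a1 * t ^ 2 - 1 - a1 / t := by field_simp; ring
    rw [e]
    nlinarith [mul_nonneg (sub_nonneg.2 haa) (sq_nonneg t)])
  have htail2 : (#(pairs (Finset.univ : Finset (Fin n))) : ℝ) * p / (t ^ 2 / 2) ^ 2 ≤ b / 2 := by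
    have h1 : (#(pairs (Finset.univ : Finset (Fin n))) : ℝ) * p ≤ t ^ 3 := by
      rw [hNp, ← ht3]
      have : 1 ≤ t ^ 3 := one_le_pow₀ (by linarith)
      nlinarith
    have h2 : 8 ≤ t * b := (div_le_iff₀ hb).1 (hT3.trans hTt)
    rw [div_le_iff₀ (by positivity)]
    have : t ^ 3 * 8 ≤ t ^ 3 * (t * b) := by gcongr
    nlinarith
  have cpos : (0:ℝ) < (n.choose 2).choose m := by exact_mod_cast Nat.choose_pos hle
  rw [hcard] at htr
  have hfin : b / 2 ≤ (#(NCs (pairs (Finset.univ : Finset (Fin n))) m) : ℝ) / (n.choose 2).choose m := by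
    linarith
  rw [le_div_iff₀ cpos] at hfin
  exact hfin.trans (by exact_mod_cast NCs_le_Ucard n m)

end Transfer
end CG

theorem stmt1 (a : ℝ) :
    ∃ b : ℝ, 0 < b ∧ ∃ N : ℕ, ∀ n : ℕ, N ≤ n → ∀ m : ℕ,
      (2 * m : ℝ) - n ≤ a * (n : ℝ) ^ ((2 : ℝ) / 3) →
      b * ((n.choose 2).choose m : ℝ) ≤ (Ucard n m : ℝ) := by
  exact CG.final a
end
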